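/- arXiv:1103.0849 — 4 statements merged into one kernel-verified Lean document; each statement's English description precedes it below -/
import Mathlib

section
/- Let l ≥ 1 and let f, f₁, …, f_l be smooth functions on ℝ^{l+2}. Define a bracket on smooth functions on ℝ^{l+2} by {g,h}(p) = f(p) · det J(p), where J(p) is the (l+2)×(l+2) matrix whose rows are the gradients ∇g(p), ∇h(p), ∇f₁(p), …, ∇f_l(p). Then this bracket satisfies the Jacobi identity {g,{h,k}} + {h,{k,g}} + {k,{g,h}} = 0 for all smooth g,h,k, each f_i (i = 1,…,l) is a Casimir ({f_i,h} = 0 for all smooth h), and the associated bivector, i.e. the antisymmetric matrix-valued function (Λ^{ij}) with Λ^{ij} = {x_i, x_j} (x_i the coordinate functions), has matrix rank at most 2 at every point. -/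
/-!
STATEMENT 1.  For smooth `f, f₁, …, f_l : ℝ^{l+2} → ℝ` (`l ≥ 1`), the bracket
`{g,h}(p) = f(p) · det (∇g(p), ∇h(p), ∇f₁(p), …, ∇f_l(p))`
satisfies the Jacobi identity, admits each `f_i` as a Casimir, and its
coefficient matrix `({x_i, x_j})` has rank at most `2` at every point.
-/

namespace Damianou1

noncomputable section

/-- Partial derivative. -/
def pd {N : ℕ} (f : (Fin N → ℝ) → ℝ) (i : Fin N) (x : Fin N → ℝ) : ℝ :=
  fderiv ℝ f x (Pi.single i 1)

/-- Gradient. -/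
def grad {N : ℕ} (f : (Fin N → ℝ) → ℝ) (x : Fin N → ℝ) : Fin N → ℝ := fun i => pd f i x

/-- The Jacobian bracket
`{g,h}(p) = f(p) · det` of the matrix with rows `∇g(p), ∇h(p), ∇f₁(p), …, ∇f_l(p)`. -/
def bra (l : ℕ) (f : (Fin (l + 2) → ℝ) → ℝ) (fs : Fin l → (Fin (l + 2) → ℝ) → ℝ)
    (g h : (Fin (l + 2) → ℝ) → ℝ) : (Fin (l + 2) → ℝ) → ℝ :=
  fun x => f x *
    Matrix.det (Matrix.of (Fin.cons (grad g x) (Fin.cons (grad h x) fun i => grad (fs i) x)))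

open Matrix in
theorem det_updateRow_eq_sum {n : Type*} [Fintype n] [DecidableEq n] (M : Matrix n n ℝ) (r : n)
    (v : n → ℝ) :
    (M.updateRow r v).det = ∑ j, v j * (M.updateRow r (Pi.single j 1)).det := by
  simp only [← cramer_transpose_apply]
  conv_lhs => rw [LinearMap.pi_apply_eq_sum_univ (cramer Mᵀ) v]
  simp only [Finset.sum_apply, Pi.smul_apply, smul_eq_mul]
  refine Finset.sum_congr rfl fun j _ => ?_
  have hj : (fun k => if j = k then (1 : ℝ) else 0) = Pi.single j 1 := by
    ext k
    simp [Pi.single_apply, eq_comm]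
  rw [hj]

/-- The determinant of the matrix with rows `a, b, C₁, …, C_l`. -/
def detCons {l : ℕ} (C : Fin l → Fin (l + 2) → ℝ) (a b : Fin (l + 2) → ℝ) : ℝ :=
  (Matrix.of (Fin.cons a (Fin.cons b C) : Fin (l + 2) → Fin (l + 2) → ℝ)).det

section Algebra

variable {l : ℕ} (C : Fin l → Fin (l + 2) → ℝ)

theorem updateRow_cons_zero (a b v : Fin (l + 2) → ℝ) :
    (Matrix.of (Fin.cons a (Fin.cons b C) : Fin (l + 2) → Fin (l + 2) → ℝ)).updateRow 0 v =
      Matrix.of (Fin.cons v (Fin.cons b C) : Fin (l + 2) → Fin (l + 2) → ℝ) :=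
  Fin.update_cons_zero (α := fun _ => Fin (l + 2) → ℝ) a _ v

theorem updateRow_cons_one (a b v : Fin (l + 2) → ℝ) :
    (Matrix.of (Fin.cons a (Fin.cons b C) : Fin (l + 2) → Fin (l + 2) → ℝ)).updateRow 1 v =
      Matrix.of (Fin.cons a (Fin.cons v C) : Fin (l + 2) → Fin (l + 2) → ℝ) := by
  have h := Fin.cons_update (α := fun _ => Fin (l + 2) → ℝ) a
    (Fin.cons (α := fun _ => Fin (l + 2) → ℝ) b C) 0 v
  rw [Fin.update_cons_zero] at h
  exact h.symm

theorem updateRow_cons_succ_succ (a b v : Fin (l + 2) → ℝ) (i : Fin l) :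
    (Matrix.of (Fin.cons a (Fin.cons b C) : Fin (l + 2) → Fin (l + 2) → ℝ)).updateRow
        i.succ.succ v =
      Matrix.of (Fin.cons a (Fin.cons b (Function.update C i v)) :
        Fin (l + 2) → Fin (l + 2) → ℝ) := by
  have h := Fin.cons_update (α := fun _ => Fin (l + 2) → ℝ) a
    (Fin.cons (α := fun _ => Fin (l + 2) → ℝ) b C) i.succ v
  rw [← Fin.cons_update] at h
  exact h.symm

theorem detCons_eq_sum_left (a b : Fin (l + 2) → ℝ) :
    detCons C a b = ∑ j, a j * detCons C (Pi.single j 1) b := by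
  have h := det_updateRow_eq_sum (Matrix.of (Fin.cons a (Fin.cons b C))) 0 a
  simp only [updateRow_cons_zero] at h
  exact h

theorem detCons_eq_sum_right (a b : Fin (l + 2) → ℝ) :
    detCons C a b = ∑ j, b j * detCons C a (Pi.single j 1) := by
  have h := det_updateRow_eq_sum (Matrix.of (Fin.cons a (Fin.cons b C))) 1 b
  simp only [updateRow_cons_one] at h
  exact h

theorem detCons_update_eq_sum (a b w : Fin (l + 2) → ℝ) (i : Fin l) :
    detCons (Function.update C i w) a b =
      ∑ j, w j * detCons (Function.update C i (Pi.single j 1)) a b := by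
  have h := det_updateRow_eq_sum (Matrix.of (Fin.cons a (Fin.cons b C))) i.succ.succ w
  simp only [updateRow_cons_succ_succ] at h
  exact h

theorem detCons_apply_left (i : Fin l) (b : Fin (l + 2) → ℝ) : detCons C (C i) b = 0 :=
  Matrix.det_zero_of_row_eq (i := 0) (j := i.succ.succ) (Fin.succ_ne_zero _).symm rfl

theorem detCons_swap (a b : Fin (l + 2) → ℝ) : detCons C b a = -detCons C a b := by
  have h := (Matrix.detRowAlternating (R := ℝ) (n := Fin (l + 2))).map_swap
    (Fin.cons (α := fun _ => Fin (l + 2) → ℝ) a (Fin.cons (α := fun _ => Fin (l + 2) → ℝ) b C))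
    (i := 0) (j := 1) (by simp)
  refine Eq.trans (congrArg Matrix.det ?_) h
  ext r k
  refine Fin.cases ?_ (fun r => Fin.cases ?_ (fun r => ?_) r) r
  · simp
  · simp
  · have h1 : r.succ.succ ≠ (1 : Fin (l + 2)) := by
      simp [Fin.ext_iff]
    simp [Function.comp, Equiv.swap_apply_of_ne_of_ne (Fin.succ_ne_zero _) h1]

theorem detCons_update_swap (a w : Fin (l + 2) → ℝ) (i : Fin l) :
    detCons (Function.update C i w) a (C i) = -detCons C a w := by
  have hne : (1 : Fin (l + 2)) ≠ i.succ.succ := by simp [Fin.ext_iff]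
  have h := (Matrix.detRowAlternating (R := ℝ) (n := Fin (l + 2))).map_swap
    (Fin.cons (α := fun _ => Fin (l + 2) → ℝ) a (Fin.cons (α := fun _ => Fin (l + 2) → ℝ) w C))
    hne
  refine Eq.trans (congrArg Matrix.det ?_) h
  ext r k
  refine Fin.cases ?_ (fun r => Fin.cases ?_ (fun r => ?_) r) r
  · have h0 : Equiv.swap (1 : Fin (l + 2)) i.succ.succ 0 = 0 :=
      Equiv.swap_apply_of_ne_of_ne (by simp) (Fin.succ_ne_zero _).symm
    simp [-Fin.cons_update, h0]
  · simp [-Fin.cons_update]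
  · have h1 : r.succ.succ ≠ (1 : Fin (l + 2)) := by
      simp [Fin.ext_iff]
    by_cases hr : r = i
    · subst hr
      simp [Function.comp]
    · have h2 : r.succ.succ ≠ i.succ.succ := by simpa using hr
      simp [Function.comp, Equiv.swap_apply_of_ne_of_ne h1 h2, hr]

open Matrix in
theorem detCons_plucker (a b c d : Fin (l + 2) → ℝ) :
    detCons C c d * detCons C a b =
      detCons C a d * detCons C c b + detCons C c a * detCons C d b := by
  set A : Matrix (Fin (l + 2)) (Fin (l + 2)) ℝ := Matrix.of (Fin.cons c (Fin.cons d C)) with hA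
  have hcr : ∀ k, ∑ r, A r k * (A.updateRow r a).det = A.det * a k := fun k => by
    have h := congrFun (mulVec_cramer Aᵀ a) k
    simpa [mulVec, dotProduct, cramer_transpose_apply, det_transpose] using h
  have hsum : A.det * detCons C a b = ∑ r, (A.updateRow r a).det * detCons C (A r) b := by
    rw [detCons_eq_sum_left, Finset.mul_sum]
    simp only [← mul_assoc, ← hcr, Finset.sum_mul]
    rw [Finset.sum_comm]
    refine Finset.sum_congr rfl fun r _ => ?_
    rw [detCons_eq_sum_left C (A r), Finset.mul_sum]
    exact Finset.sum_congr rfl fun j _ => by ring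
  rw [Fin.sum_univ_succ, Fin.sum_univ_succ] at hsum
  have hz : ∑ i : Fin l, (A.updateRow i.succ.succ a).det * detCons C (A i.succ.succ) b = 0 :=
    Finset.sum_eq_zero fun i _ => by
      rw [show A i.succ.succ = C i from rfl, detCons_apply_left, mul_zero]
  rw [hz, add_zero, hA, updateRow_cons_zero, Fin.succ_zero_eq_one, updateRow_cons_one] at hsum
  exact hsum

theorem detCons_plucker_cyclic (a b c v : Fin (l + 2) → ℝ) :
    detCons C a v * detCons C b c + detCons C b v * detCons C c a +
      detCons C c v * detCons C a b = 0 := by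
  have h := detCons_plucker C b c a v
  rw [detCons_swap C c v] at h
  rw [detCons_swap C a c]
  linear_combination h

/-- Two contractions of a symmetric matrix with the vector fields of `u` and `v` agree. -/
theorem sum_detCons_mul_comm {S : Fin (l + 2) → Fin (l + 2) → ℝ} (hS : ∀ i j, S i j = S j i)
    (u v : Fin (l + 2) → ℝ) :
    ∑ j, detCons C u (S j) * detCons C v (Pi.single j 1) =
      ∑ j, detCons C v (S j) * detCons C u (Pi.single j 1) := by
  simp only [detCons_eq_sum_right C _ (S _), Finset.sum_mul]
  rw [Finset.sum_comm]
  refine Finset.sum_congr rfl fun i _ => Finset.sum_congr rfl fun j _ => ?_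
  rw [hS i j]
  ring

theorem detCons_update_cyclic_self (a b c w : Fin (l + 2) → ℝ) (i : Fin l) :
    detCons (Function.update C i w) b c * detCons C a w +
      detCons (Function.update C i w) c a * detCons C b w +
      detCons (Function.update C i w) a b * detCons C c w = 0 := by
  have h := detCons_plucker_cyclic (Function.update C i w) a b c (C i)
  simp only [detCons_update_swap] at h
  linear_combination -h

theorem detCons_update_add (a b w w' : Fin (l + 2) → ℝ) (i : Fin l) :
    detCons (Function.update C i (w + w')) a b =
      detCons (Function.update C i w) a b + detCons (Function.update C i w') a b := by
  rw [detCons_update_eq_sum, detCons_update_eq_sum C a b w, detCons_update_eq_sum C a b w',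
    ← Finset.sum_add_distrib]
  exact Finset.sum_congr rfl fun j _ => by rw [Pi.add_apply, add_mul]

theorem detCons_add_right (a w w' : Fin (l + 2) → ℝ) :
    detCons C a (w + w') = detCons C a w + detCons C a w' := by
  rw [detCons_eq_sum_right, detCons_eq_sum_right C a w, detCons_eq_sum_right C a w',
    ← Finset.sum_add_distrib]
  exact Finset.sum_congr rfl fun j _ => by rw [Pi.add_apply, add_mul]

theorem detCons_smul_right (a w : Fin (l + 2) → ℝ) (s : ℝ) :
    detCons C a (s • w) = s * detCons C a w := by
  rw [detCons_eq_sum_right, detCons_eq_sum_right C a w, Finset.mul_sum]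
  exact Finset.sum_congr rfl fun j _ => by rw [Pi.smul_apply, smul_eq_mul, mul_assoc]

theorem sum_detCons_update_cyclic {S : Fin (l + 2) → Fin (l + 2) → ℝ}
    (hS : ∀ i j, S i j = S j i) (a b c : Fin (l + 2) → ℝ) (i : Fin l) :
    ∑ j, (detCons (Function.update C i (S j)) b c * detCons C a (Pi.single j 1) +
      detCons (Function.update C i (S j)) c a * detCons C b (Pi.single j 1) +
      detCons (Function.update C i (S j)) a b * detCons C c (Pi.single j 1)) = 0 := by
  let Q : (Fin (l + 2) → ℝ) → (Fin (l + 2) → ℝ) → ℝ := fun w w' =>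
    detCons (Function.update C i w) b c * detCons C a w' +
      detCons (Function.update C i w) c a * detCons C b w' +
      detCons (Function.update C i w) a b * detCons C c w'
  have hQ : ∀ w w', Q w w' = -Q w' w := fun w w' => by
    have h := detCons_update_cyclic_self C a b c (w + w') i
    have h1 := detCons_update_cyclic_self C a b c w i
    have h2 := detCons_update_cyclic_self C a b c w' i
    simp only [detCons_update_add, detCons_add_right] at h
    simp only [Q]
    linear_combination h - h1 - h2
  have hexp : ∀ j, Q (S j) (Pi.single j 1) =
      ∑ k, S j k * Q (Pi.single k 1) (Pi.single j 1) := fun j => by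
    simp only [Q]
    rw [detCons_update_eq_sum C b c, detCons_update_eq_sum C c a, detCons_update_eq_sum C a b,
      Finset.sum_mul, Finset.sum_mul, Finset.sum_mul, ← Finset.sum_add_distrib,
      ← Finset.sum_add_distrib]
    exact Finset.sum_congr rfl fun k _ => by ring
  change ∑ j, Q (S j) (Pi.single j 1) = 0
  simp only [hexp]
  have hneg : ∑ j, ∑ k, S j k * Q (Pi.single k 1) (Pi.single j 1) =
      -∑ j, ∑ k, S j k * Q (Pi.single k 1) (Pi.single j 1) := by
    conv_lhs => rw [Finset.sum_comm]
    simp only [← Finset.sum_neg_distrib]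
    refine Finset.sum_congr rfl fun j _ => Finset.sum_congr rfl fun k _ => ?_
    rw [hS k j, hQ]
    ring
  linarith

/-- The derivative in the `j`-th direction of `detCons`, when the rows `b`, `c`, `C i` have
derivatives `Hb j`, `Hc j`, `HC i j`. -/
def detConsDeriv (HC : Fin l → Fin (l + 2) → Fin (l + 2) → ℝ) (b c : Fin (l + 2) → ℝ)
    (Hb Hc : Fin (l + 2) → Fin (l + 2) → ℝ) (j : Fin (l + 2)) : ℝ :=
  detCons C (Hb j) c + (detCons C b (Hc j) +
    ∑ i, detCons (Function.update C i (HC i j)) b c)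

theorem sum_detConsDeriv (HC : Fin l → Fin (l + 2) → Fin (l + 2) → ℝ) (a b c : Fin (l + 2) → ℝ)
    (Hb Hc : Fin (l + 2) → Fin (l + 2) → ℝ) :
    ∑ j, detConsDeriv C HC b c Hb Hc j * detCons C a (Pi.single j 1) =
      -∑ j, detCons C c (Hb j) * detCons C a (Pi.single j 1) +
      ∑ j, detCons C b (Hc j) * detCons C a (Pi.single j 1) +
      ∑ i, ∑ j, detCons (Function.update C i (HC i j)) b c * detCons C a (Pi.single j 1) := by
  rw [Finset.sum_comm (s := (Finset.univ : Finset (Fin l))), ← Finset.sum_neg_distrib,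
    ← Finset.sum_add_distrib, ← Finset.sum_add_distrib]
  refine Finset.sum_congr rfl fun j _ => ?_
  rw [detConsDeriv, ← Finset.sum_mul, detCons_swap C c (Hb j)]
  ring

theorem detConsDeriv_cyclic {HC : Fin l → Fin (l + 2) → Fin (l + 2) → ℝ}
    {a b c : Fin (l + 2) → ℝ} {Ha Hb Hc : Fin (l + 2) → Fin (l + 2) → ℝ}
    (hC : ∀ i j k, HC i j k = HC i k j) (ha : ∀ j k, Ha j k = Ha k j)
    (hb : ∀ j k, Hb j k = Hb k j) (hc : ∀ j k, Hc j k = Hc k j) :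
    detCons C a (detConsDeriv C HC b c Hb Hc) + detCons C b (detConsDeriv C HC c a Hc Ha) +
      detCons C c (detConsDeriv C HC a b Ha Hb) = 0 := by
  have hs : ∑ i, ∑ j, detCons (Function.update C i (HC i j)) b c * detCons C a (Pi.single j 1) +
      ∑ i, ∑ j, detCons (Function.update C i (HC i j)) c a * detCons C b (Pi.single j 1) +
      ∑ i, ∑ j, detCons (Function.update C i (HC i j)) a b * detCons C c (Pi.single j 1) = 0 := by
    simp only [← Finset.sum_add_distrib]
    exact Finset.sum_eq_zero fun i _ => sum_detCons_update_cyclic C (hC i) a b c i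
  rw [detCons_eq_sum_right C a, detCons_eq_sum_right C b, detCons_eq_sum_right C c,
    sum_detConsDeriv, sum_detConsDeriv, sum_detConsDeriv]
  linear_combination hs - sum_detCons_mul_comm C ha b c - sum_detCons_mul_comm C hb c a -
    sum_detCons_mul_comm C hc a b

theorem rank_detCons_le (s : ℝ) :
    (Matrix.of fun i j : Fin (l + 2) =>
      s * detCons C (Pi.single i 1) (Pi.single j 1)).rank ≤ 2 := by
  by_cases h0 : ∃ c d, detCons C c d ≠ 0
  · obtain ⟨c, d, hcd⟩ := h0
    let P : Matrix (Fin (l + 2)) (Fin 2) ℝ := Matrix.of fun i =>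
      ![detCons C (Pi.single i 1) d, detCons C c (Pi.single i 1)]
    let R : Matrix (Fin 2) (Fin (l + 2)) ℝ := Matrix.of fun m j =>
      s * (detCons C c d)⁻¹ * ![detCons C c (Pi.single j 1), detCons C d (Pi.single j 1)] m
    have h : (Matrix.of fun i j : Fin (l + 2) =>
        s * detCons C (Pi.single i 1) (Pi.single j 1)) = P * R := by
      ext i j
      have hp := detCons_plucker C (Pi.single i 1) (Pi.single j 1) c d
      simp only [Matrix.of_apply, Matrix.mul_apply, Fin.sum_univ_two, P, R, Matrix.cons_val_zero,
        Matrix.cons_val_one]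
      field_simp
      linear_combination s * hp
    rw [h]
    exact (Matrix.rank_mul_le_left P R).trans P.rank_le_width
  · push Not at h0
    simp only [h0, mul_zero]
    exact (Matrix.rank_zero (R := ℝ) (m := Fin (l + 2)) (n := Fin (l + 2))).le.trans (by simp)

end Algebra

section Calculus

variable {N : ℕ}

theorem contDiff_pd {u : (Fin N → ℝ) → ℝ} (hu : ContDiff ℝ (⊤ : ℕ∞) u) (i : Fin N) :
    ContDiff ℝ (⊤ : ℕ∞) (pd u i) :=
  (hu.fderiv_right (m := (⊤ : ℕ∞)) (by simp)).clm_apply contDiff_const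

theorem pd_pd_comm {u : (Fin N → ℝ) → ℝ} (hu : ContDiff ℝ (⊤ : ℕ∞) u) (i j : Fin N)
    (x : Fin N → ℝ) : pd (pd u i) j x = pd (pd u j) i x := by
  have hd : DifferentiableAt ℝ (fderiv ℝ u) x :=
    (hu.fderiv_right (m := (⊤ : ℕ∞)) (by simp)).differentiable (by simp) x
  have hpd : ∀ i j, pd (pd u i) j x =
      fderiv ℝ (fderiv ℝ u) x (Pi.single j 1) (Pi.single i 1) := fun i j => by
    change fderiv ℝ (fun y => fderiv ℝ u y (Pi.single i 1)) x (Pi.single j 1) = _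
    rw [fderiv_clm_apply hd (differentiableAt_const _)]
    simp
  rw [hpd, hpd]
  exact (hu.contDiffAt.isSymmSndFDerivAt (by
    simpa using WithTop.coe_le_coe.2 (le_top (a := (2 : ℕ∞))))).eq _ _

theorem grad_eval (i : Fin N) (x : Fin N → ℝ) : grad (fun y => y i) x = Pi.single i 1 := by
  ext j
  have h : fderiv ℝ (fun y : Fin N → ℝ => y i) x = ContinuousLinearMap.proj i :=
    (ContinuousLinearMap.proj (R := ℝ) (φ := fun _ : Fin N => ℝ) i).fderiv
  simp [grad, pd, h, Pi.single_apply, eq_comm]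

theorem hasFDerivAt_det {n E : Type*} [Fintype n] [DecidableEq n] [NormedAddCommGroup E]
    [NormedSpace ℝ E] {M : E → n → n → ℝ} {M' : E →L[ℝ] n → n → ℝ} {x : E}
    (hM : HasFDerivAt M M' x) :
    ∃ L : E →L[ℝ] ℝ, HasFDerivAt (fun y => (Matrix.of (M y)).det) L x ∧
      ∀ v, L v = ∑ r, ((Matrix.of (M x)).updateRow r (M' v r)).det := by
  let D : ContinuousMultilinearMap ℝ (fun _ : n => n → ℝ) ℝ :=
    ⟨Matrix.detRowAlternating.toMultilinearMap, continuous_id.matrix_det⟩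
  refine ⟨(D.linearDeriv (M x)).comp M', (D.hasFDerivAt (M x)).comp x hM, fun v => ?_⟩
  rw [ContinuousLinearMap.comp_apply, ContinuousMultilinearMap.linearDeriv_apply]
  rfl

theorem hasFDerivAt_grad {u : (Fin N → ℝ) → ℝ} (hu : ContDiff ℝ (⊤ : ℕ∞) u) (x : Fin N → ℝ) :
    HasFDerivAt (grad u) (ContinuousLinearMap.pi fun i => fderiv ℝ (pd u i) x) x :=
  hasFDerivAt_pi.2 fun i => ((contDiff_pd hu i).differentiable (by simp) x).hasFDerivAt

/-- The Hessian matrix. -/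
def hess (u : (Fin N → ℝ) → ℝ) (x : Fin N → ℝ) (j i : Fin N) : ℝ := pd (pd u i) j x

theorem pd_mul_det_grad {u : (Fin N → ℝ) → ℝ} (hu : ContDiff ℝ (⊤ : ℕ∞) u)
    {F : Fin N → (Fin N → ℝ) → ℝ} (hF : ∀ r, ContDiff ℝ (⊤ : ℕ∞) (F r)) (j : Fin N)
    (x : Fin N → ℝ) :
    pd (fun y => u y * (Matrix.of fun r => grad (F r) y).det) j x =
      (Matrix.of fun r => grad (F r) x).det * pd u j x +
        u x * ∑ r, ((Matrix.of fun r => grad (F r) x).updateRow r (hess (F r) x j)).det := by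
  have hM : HasFDerivAt (fun y r => grad (F r) y) (ContinuousLinearMap.pi fun r =>
      ContinuousLinearMap.pi fun i => fderiv ℝ (pd (F r) i) x) x :=
    hasFDerivAt_pi.2 fun r => hasFDerivAt_grad (hF r) x
  obtain ⟨L, hL, hLv⟩ := hasFDerivAt_det hM
  have hmul := ((hu.differentiable (by simp) x).hasFDerivAt).mul hL
  have hj := hLv (Pi.single j 1)
  have key : pd (fun y => u y * (Matrix.of fun r => grad (F r) y).det) j x =
      u x * L (Pi.single j 1) + (Matrix.of fun r => grad (F r) x).det * pd u j x :=
    congrArg (fun T : (Fin N → ℝ) →L[ℝ] ℝ => T (Pi.single j 1)) hmul.fderiv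
  rw [key, hj, add_comm]
  rfl

end Calculus

section Bracket

variable {l : ℕ} {f : (Fin (l + 2) → ℝ) → ℝ} {fs : Fin l → (Fin (l + 2) → ℝ) → ℝ}

theorem bra_eq (g h : (Fin (l + 2) → ℝ) → ℝ) (x : Fin (l + 2) → ℝ) :
    bra l f fs g h x = f x * detCons (fun i => grad (fs i) x) (grad g x) (grad h x) :=
  rfl

theorem grad_bra (hf : ContDiff ℝ (⊤ : ℕ∞) f) (hfs : ∀ i, ContDiff ℝ (⊤ : ℕ∞) (fs i))
    {g h : (Fin (l + 2) → ℝ) → ℝ} (hg : ContDiff ℝ (⊤ : ℕ∞) g) (hh : ContDiff ℝ (⊤ : ℕ∞) h)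
    (x : Fin (l + 2) → ℝ) :
    grad (bra l f fs g h) x =
      detCons (fun i => grad (fs i) x) (grad g x) (grad h x) • grad f x +
      f x • detConsDeriv (fun i => grad (fs i) x) (fun i => hess (fs i) x) (grad g x) (grad h x)
        (hess g x) (hess h x) := by
  obtain ⟨F, hF0, hF1, hFs⟩ : ∃ F : Fin (l + 2) → (Fin (l + 2) → ℝ) → ℝ,
      F 0 = g ∧ F 1 = h ∧ ∀ i : Fin l, F i.succ.succ = fs i :=
    ⟨Fin.cons g (Fin.cons h fs), rfl, rfl, fun _ => rfl⟩
  have hF : ∀ r, ContDiff ℝ (⊤ : ℕ∞) (F r) := by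
    refine Fin.cases (hF0 ▸ hg) (Fin.cases ?_ fun i => ?_)
    · rwa [Fin.succ_zero_eq_one, hF1]
    · rw [hFs]
      exact hfs i
  have hrow : ∀ y, (fun r => grad (F r) y) = (Fin.cons (grad g y) (Fin.cons (grad h y)
      fun i => grad (fs i) y) : Fin (l + 2) → Fin (l + 2) → ℝ) := fun y => by
    refine funext (Fin.cases ?_ (Fin.cases ?_ fun i => ?_))
    · rw [hF0, Fin.cons_zero]
    · rw [Fin.succ_zero_eq_one, hF1]
      rfl
    · rw [hFs, Fin.cons_succ, Fin.cons_succ]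
  ext j
  have hpd := pd_mul_det_grad hf hF j x
  simp only [hrow] at hpd
  rw [Fin.sum_univ_succ, Fin.sum_univ_succ, updateRow_cons_zero, Fin.succ_zero_eq_one,
    updateRow_cons_one] at hpd
  simp only [updateRow_cons_succ_succ, hF0, hF1, hFs] at hpd
  exact hpd

end Bracket

theorem jacobi_casimir_rank_of_jacobian_bracket
    (l : ℕ) (hl : 1 ≤ l)
    (f : (Fin (l + 2) → ℝ) → ℝ) (hf : ContDiff ℝ (⊤ : ℕ∞) f)
    (fs : Fin l → (Fin (l + 2) → ℝ) → ℝ) (hfs : ∀ i, ContDiff ℝ (⊤ : ℕ∞) (fs i)) :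
    (∀ g h k : (Fin (l + 2) → ℝ) → ℝ,
        ContDiff ℝ (⊤ : ℕ∞) g → ContDiff ℝ (⊤ : ℕ∞) h → ContDiff ℝ (⊤ : ℕ∞) k →
        ∀ x, bra l f fs g (bra l f fs h k) x + bra l f fs h (bra l f fs k g) x +
              bra l f fs k (bra l f fs g h) x = 0) ∧
    (∀ i : Fin l, ∀ h : (Fin (l + 2) → ℝ) → ℝ, ContDiff ℝ (⊤ : ℕ∞) h →
        ∀ x, bra l f fs (fs i) h x = 0) ∧
    (∀ x, Matrix.rank
        (Matrix.of fun i j : Fin (l + 2) => bra l f fs (fun y => y i) (fun y => y j) x) ≤ 2) := by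
  refine ⟨fun g h k hg hh hk x => ?_, fun i h _ x => ?_, fun x => ?_⟩
  · rw [bra_eq, bra_eq, bra_eq, grad_bra hf hfs hh hk, grad_bra hf hfs hk hg,
      grad_bra hf hfs hg hh]
    simp only [detCons_add_right, detCons_smul_right]
    have h1 := detCons_plucker_cyclic (fun i => grad (fs i) x) (grad g x) (grad h x) (grad k x)
      (grad f x)
    have h2 := detConsDeriv_cyclic (fun i => grad (fs i) x) (HC := fun i => hess (fs i) x)
      (a := grad g x) (b := grad h x) (c := grad k x)
      (Ha := hess g x) (Hb := hess h x) (Hc := hess k x)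
      (fun i j m => pd_pd_comm (hfs i) m j x) (fun j m => pd_pd_comm hg m j x)
      (fun j m => pd_pd_comm hh m j x) (fun j m => pd_pd_comm hk m j x)
    linear_combination f x * h1 + f x * f x * h2
  · rw [bra_eq, detCons_apply_left (fun i => grad (fs i) x) i, mul_zero]
  · simp only [bra_eq, grad_eval]
    exact rank_detCons_le _ _

end
end Damianou1
end

section
/- Let 1 ≤ k ≤ n − 1, let f₁, …, f_{2n−2k} be smooth functions on M, and let p ∈ M be a point at which the differentials df₁, …, df_{2n−2k} are linearly independent. Then there exist an open neighborhood U ⊆ M of p and a bivector field Λ₀ on U that is nondegenerate (of rank 2n) at every point of U, such that the function ⟨df₁∧⋯∧df_{2n−2k}, Λ₀^{n−k}/(n−k)!⟩ is nonvanishing on U (indeed one can take it identically equal to 1). -/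
namespace Damianou

noncomputable section

/-- Points of `ℝ^N`. -/
abbrev Pt (N : ℕ) := Fin N → ℝ

/-- Raw coordinate representation of a differential `p`-form (or, dually, of a
`p`-vector field): to each point we assign the array of its components. -/
abbrev Form (N p : ℕ) := Pt N → (Fin p → Fin N) → ℝ

/-- The component array of an alternating (antisymmetric) tensor. -/
def AltArr {N p : ℕ} (f : (Fin p → Fin N) → ℝ) : Prop :=
  (∀ (I : Fin p → Fin N) (σ : Equiv.Perm (Fin p)),
      f (I ∘ σ) = ((Equiv.Perm.sign σ : ℤ) : ℝ) * f I) ∧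
  ∀ I : Fin p → Fin N, ¬ Function.Injective I → f I = 0

/-- `ω` is a (smooth) differential `p`-form on the set `M`. -/
def IsFormOn {N p : ℕ} (ω : Form N p) (M : Set (Pt N)) : Prop :=
  (∀ x ∈ M, AltArr (ω x)) ∧ ∀ I, ContDiffOn ℝ (⊤ : ℕ∞) (fun x => ω x I) M

/-- The pairing `⟨η, P⟩` of a `p`-form with a `p`-vector field, determined by
`⟨η₁∧⋯∧η_p, X₁∧⋯∧X_p⟩ = det (⟨η_i, X_j⟩)`. -/
def pairF {N p : ℕ} (η P : Form N p) : Pt N → ℝ :=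
  fun x => (p.factorial : ℝ)⁻¹ * ∑ I : Fin p → Fin N, η x I * P x I

/-- Wedge product (determinant convention). -/
def wedgeF {N : ℕ} (p q : ℕ) (ω : Form N p) (η : Form N q) : Form N (p + q) :=
  fun x I => ((p.factorial : ℝ) * (q.factorial : ℝ))⁻¹ *
    ∑ σ : Equiv.Perm (Fin (p + q)), ((Equiv.Perm.sign σ : ℤ) : ℝ) *
      (ω x fun i => I (σ (Fin.castAdd q i))) * (η x fun j => I (σ (Fin.natAdd p j)))

def smulF {N p : ℕ} (c : ℝ) (ω : Form N p) : Form N p := fun x I => c * ω x I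
def fsmulF {N p : ℕ} (c : Pt N → ℝ) (ω : Form N p) : Form N p := fun x I => c x * ω x I
def addF {N p : ℕ} (ω η : Form N p) : Form N p := fun x I => ω x I + η x I
def subF {N p : ℕ} (ω η : Form N p) : Form N p := fun x I => ω x I - η x I

/-- Cast between (propositionally) equal degrees. -/
def castF {N p q : ℕ} (h : p = q) (ω : Form N p) : Form N q :=
  fun x J => ω x fun t => J (Fin.cast h t)

/-- Total cast, defaulting to `0` when the degrees differ. -/
def castT {N p q : ℕ} (ω : Form N p) : Form N q :=
  if h : p = q then castF h ω else fun _ _ => 0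

/-- Partial derivative `∂f/∂x_i`. -/
def pd {N : ℕ} (f : Pt N → ℝ) (i : Fin N) (x : Pt N) : ℝ :=
  fderiv ℝ f x (Pi.single i 1)

/-- The gradient covector of a function. -/
def grad {N : ℕ} (f : Pt N → ℝ) (x : Pt N) : Fin N → ℝ := fun i => pd f i x

/-- The differential of a function, as a `1`-form. -/
def dF {N : ℕ} (f : Pt N → ℝ) : Form N 1 := fun x I => pd f (I 0) x

/-- Exterior derivative. -/
def extd {N p : ℕ} (ω : Form N p) : Form N (p + 1) :=
  fun x I => ∑ i : Fin (p + 1), (-1 : ℝ) ^ (i : ℕ) *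
    fderiv ℝ (fun y => ω y fun j => I (i.succAbove j)) x (Pi.single (I i) 1)

/-- Concatenation of index blocks of lengths `a` and `b - a` into `Fin b`. -/
def catIdx {N a b : ℕ} (u : Fin a → Fin N) (v : Fin (b - a) → Fin N) : Fin b → Fin N :=
  fun t => if h : (t : ℕ) < a then u ⟨t, h⟩
    else v ⟨(t : ℕ) - a, by have := t.isLt; omega⟩

/-- Concatenation of index blocks of lengths `b - c` and `c` into `Fin b`. -/
def catIdx' {N c b : ℕ} (u : Fin (b - c) → Fin N) (v : Fin c → Fin N) : Fin b → Fin N :=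
  fun t => if h : (t : ℕ) < b - c then u ⟨t, h⟩
    else v ⟨(t : ℕ) - (b - c), by have := t.isLt; omega⟩

/-- Interior product `i_P η` of a `q`-form `η` by a `p`-vector field `P`;
it satisfies `⟨i_P η, Q⟩ = (-1)^{p(p-1)/2} ⟨η, P ∧ Q⟩`. -/
def iF {N : ℕ} (p q : ℕ) (P : Form N p) (η : Form N q) : Form N (q - p) :=
  fun x J => (-1 : ℝ) ^ (p * (p - 1) / 2) * (p.factorial : ℝ)⁻¹ *
    ∑ I : Fin p → Fin N, P x I * η x (catIdx I J)

/-- Interior product `j_η P` of an `r`-vector field `P` by a `q`-form `η`;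
it satisfies `⟨ζ, j_η P⟩ = ⟨ζ ∧ η, P⟩`. -/
def jF {N : ℕ} (q r : ℕ) (η : Form N q) (P : Form N r) : Form N (r - q) :=
  fun x B => (q.factorial : ℝ)⁻¹ * ∑ A : Fin q → Fin N, η x A * P x (catIdx' B A)

/-- The extension of `Λ₀^#` to `p`-forms:
`Λ₀^#(ζ)(α₁,…,α_p) = (-1)^p ζ(Λ₀^#(α₁),…,Λ₀^#(α_p))`, in coordinates. -/
def sharpF {N : ℕ} (Λ : Form N 2) (p : ℕ) (ζ : Form N p) : Form N p :=
  fun x J => (-1 : ℝ) ^ p * ∑ I : Fin p → Fin N, ζ x I * ∏ t, Λ x ![I t, J t]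

/-- `Λ^#` applied to a covector: `⟨β, Λ^#(α)⟩ = Λ(α,β)`. -/
def sharpV {N : ℕ} (Λ : Form N 2) (α : Fin N → ℝ) (x : Pt N) : Fin N → ℝ :=
  fun j => ∑ i, Λ x ![i, j] * α i

/-- The hamiltonian vector field `X_f = Λ₀^#(df)`. -/
def hamV {N : ℕ} (Λ : Form N 2) (f : Pt N → ℝ) (x : Pt N) : Fin N → ℝ :=
  sharpV Λ (grad f x) x

/-- Coefficient matrix of a 2-form (or of a bivector field) at a point. -/
def mat2 {N : ℕ} (ω : Form N 2) (x : Pt N) : Matrix (Fin N) (Fin N) ℝ :=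
  Matrix.of fun i j => ω x ![i, j]

/-- The bracket `{g,h} = Λ(dg,dh)` associated with a bivector field. -/
def braF {N : ℕ} (Λ : Form N 2) (g h : Pt N → ℝ) : Pt N → ℝ :=
  fun x => ∑ i, ∑ j, Λ x ![i, j] * pd g i x * pd h j x

/-- The Jacobi identity for the bracket of `Λ`, for all functions smooth on `M`. -/
def JacobiOn {N : ℕ} (Λ : Form N 2) (M : Set (Pt N)) : Prop :=
  ∀ g h k : Pt N → ℝ, ContDiffOn ℝ (⊤ : ℕ∞) g M → ContDiffOn ℝ (⊤ : ℕ∞) h M →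
    ContDiffOn ℝ (⊤ : ℕ∞) k M →
    ∀ x ∈ M, braF Λ g (braF Λ h k) x + braF Λ h (braF Λ k g) x + braF Λ k (braF Λ g h) x = 0

/-- `f` is a Casimir of `Λ` on `M`, i.e. `Λ(df,·) = 0` on `M`. -/
def CasimirOn {N : ℕ} (Λ : Form N 2) (f : Pt N → ℝ) (M : Set (Pt N)) : Prop :=
  ∀ x ∈ M, ∀ b, ∑ a, Λ x ![a, b] * grad f x a = 0

/-- Wedge powers of a `2`-form (or of a bivector field). -/
def wpow {N : ℕ} (ω : Form N 2) : (m : ℕ) → Form N (2 * m)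
  | 0 => fun _ _ => 1
  | m + 1 => wedgeF (2 * m) 2 (wpow ω m) ω

/-- The wedge `α₁ ∧ ⋯ ∧ α_m` of a family of `1`-forms. -/
def wedgeList {N : ℕ} : (m : ℕ) → (Fin m → Form N 1) → Form N m
  | 0, _ => fun _ _ => 1
  | m + 1, α => wedgeF m 1 (wedgeList m fun i => α i.castSucc) (α (Fin.last m))

/-- `ω₀` is an almost symplectic structure on `M` with associated (nondegenerate)
bivector field `Λ₀`:  `Λ₀^#` is the inverse of `X ↦ -ω₀(X,·)`, which in coordinates
reads `(mat2 ω₀ x) * (mat2 Λ₀ x) = -1`. -/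
def AlmostSymp {N : ℕ} (ω₀ Λ₀ : Form N 2) (M : Set (Pt N)) : Prop :=
  IsFormOn ω₀ M ∧ IsFormOn Λ₀ M ∧ ∀ x ∈ M, mat2 ω₀ x * mat2 Λ₀ x = -1

/-- `ωⁿ/n!`; for an almost symplectic `ω₀` on `ℝ^{2n}` this is the volume form `Ω`,
and for `Λ₀` it is the dual `2n`-vector field `Ω̃`. -/
def volF {N : ℕ} (n : ℕ) (ω : Form N 2) : Form N (2 * n) :=
  smulF ((n.factorial : ℝ)⁻¹) (wpow ω n)

/-- The adjoint `*φ = (-1)^{p(p-1)/2} i_{Λ₀^#(φ)} (ω₀ⁿ/n!)` of a `p`-form. -/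
def adjF {n : ℕ} (ω₀ Λ₀ : Form (2 * n) 2) (p : ℕ) (φ : Form (2 * n) p) :
    Form (2 * n) (2 * n - p) :=
  smulF ((-1 : ℝ) ^ (p * (p - 1) / 2)) (iF p (2 * n) (sharpF Λ₀ p φ) (volF n ω₀))

/-- The codifferential `δ = * ∘ d ∘ *`. -/
def codiffF {n : ℕ} (ω₀ Λ₀ : Form (2 * n) 2) (p : ℕ) (φ : Form (2 * n) p) :
    Form (2 * n) (p - 1) :=
  castT (adjF ω₀ Λ₀ (2 * n - p + 1) (extd (adjF ω₀ Λ₀ p φ)))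

/-- The compatibility condition `2 σ ∧ δ(σ) = δ(σ ∧ σ)` on `M`. -/
def DeltaCond {n : ℕ} (ω₀ Λ₀ σ : Form (2 * n) 2) (M : Set (Pt (2 * n))) : Prop :=
  ∀ x ∈ M, ∀ I : Fin 3 → Fin (2 * n),
    smulF 2 (wedgeF 2 1 σ (codiffF ω₀ Λ₀ 2 σ)) x I = codiffF ω₀ Λ₀ 4 (wedgeF 2 2 σ σ) x I

/-- The permutation of `Fin (p + q)` acting by `τ` on the first `p` indices. -/
def extendPerm {p : ℕ} (q : ℕ) (τ : Equiv.Perm (Fin p)) : Equiv.Perm (Fin (p + q)) :=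
  finSumFinEquiv.permCongr (Equiv.sumCongr τ 1)

theorem extendPerm_castAdd {p q : ℕ} (τ : Equiv.Perm (Fin p)) (i : Fin p) :
    extendPerm q τ (Fin.castAdd q i) = Fin.castAdd q (τ i) := by
  simp [extendPerm, Equiv.permCongr_apply]

theorem extendPerm_natAdd {p q : ℕ} (τ : Equiv.Perm (Fin p)) (j : Fin q) :
    extendPerm q τ (Fin.natAdd p j) = Fin.natAdd p j := by
  simp [extendPerm, Equiv.permCongr_apply]

theorem sign_extendPerm {p q : ℕ} (τ : Equiv.Perm (Fin p)) :
    Equiv.Perm.sign (extendPerm q τ) = Equiv.Perm.sign τ := by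
  rw [extendPerm, Equiv.Perm.sign_permCongr]
  exact (Equiv.Perm.sign_sumCongr τ 1).trans (by simp)

theorem sign_mul_sign_cast {α : Type*} [Fintype α] [DecidableEq α] (σ : Equiv.Perm α) :
    ((Equiv.Perm.sign σ : ℤ) : ℝ) * ((Equiv.Perm.sign σ : ℤ) : ℝ) = 1 := by
  rw [← Int.cast_mul, ← Units.val_mul, Int.units_mul_self]
  simp

/-- The wedge product of an antisymmetrization with `η` is a single antisymmetrization. -/
theorem wedgeF_antisymmetrization {N p q : ℕ} (ω : Form N p) (η : Form N q) (x : Pt N) (c : ℝ)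
    (F : (Fin p → Fin N) → ℝ)
    (hω : ∀ I, ω x I = c * ∑ τ : Equiv.Perm (Fin p),
      ((Equiv.Perm.sign τ : ℤ) : ℝ) * F (fun i => I (τ i)))
    (I : Fin (p + q) → Fin N) :
    wedgeF p q ω η x I = c * (q.factorial : ℝ)⁻¹ * ∑ σ : Equiv.Perm (Fin (p + q)),
      ((Equiv.Perm.sign σ : ℤ) : ℝ) *
        (F (fun i => I (σ (Fin.castAdd q i))) * η x fun j => I (σ (Fin.natAdd p j))) := by
  have key : ∀ τ : Equiv.Perm (Fin p),
      ∑ σ : Equiv.Perm (Fin (p + q)), ((Equiv.Perm.sign σ : ℤ) : ℝ) *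
        (((Equiv.Perm.sign τ : ℤ) : ℝ) * F (fun i => I (σ (Fin.castAdd q (τ i)))) *
          η x fun j => I (σ (Fin.natAdd p j))) =
      ∑ σ : Equiv.Perm (Fin (p + q)), ((Equiv.Perm.sign σ : ℤ) : ℝ) *
        (F (fun i => I (σ (Fin.castAdd q i))) * η x fun j => I (σ (Fin.natAdd p j))) := by
    intro τ
    rw [← Equiv.sum_comp (Equiv.mulRight (extendPerm q τ)) (fun σ : Equiv.Perm (Fin (p + q)) =>
      ((Equiv.Perm.sign σ : ℤ) : ℝ) *
        (F (fun i => I (σ (Fin.castAdd q i))) * η x fun j => I (σ (Fin.natAdd p j))))]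
    refine Finset.sum_congr rfl fun σ _ => ?_
    simp only [Equiv.coe_mulRight, Equiv.Perm.mul_apply, extendPerm_castAdd, extendPerm_natAdd,
      Equiv.Perm.sign_mul, sign_extendPerm, Units.val_mul, Int.cast_mul]
    ring
  have hp : (p.factorial : ℝ) ≠ 0 := by positivity
  have hsum : ∑ σ : Equiv.Perm (Fin (p + q)), ((Equiv.Perm.sign σ : ℤ) : ℝ) *
      (ω x fun i => I (σ (Fin.castAdd q i))) * (η x fun j => I (σ (Fin.natAdd p j))) =
      c * ∑ τ : Equiv.Perm (Fin p), ∑ σ : Equiv.Perm (Fin (p + q)),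
        ((Equiv.Perm.sign σ : ℤ) : ℝ) *
        (((Equiv.Perm.sign τ : ℤ) : ℝ) * F (fun i => I (σ (Fin.castAdd q (τ i)))) *
          η x fun j => I (σ (Fin.natAdd p j))) := by
    rw [Finset.sum_comm, Finset.mul_sum]
    refine Finset.sum_congr rfl fun σ _ => ?_
    rw [hω]
    simp only [Finset.mul_sum, Finset.sum_mul]
    refine Finset.sum_congr rfl fun τ _ => ?_
    ring
  rw [wedgeF, hsum, Finset.sum_congr rfl fun τ _ => key τ]
  simp only [Finset.sum_const, Finset.card_univ, Fintype.card_perm, Fintype.card_fin,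
    nsmul_eq_mul]
  field_simp

theorem wedgeList_eq_sum_perm {N : ℕ} (q : ℕ) (α : Fin q → Form N 1) (x : Pt N)
    (I : Fin q → Fin N) :
    wedgeList q α x I = ∑ τ : Equiv.Perm (Fin q), ((Equiv.Perm.sign τ : ℤ) : ℝ) *
      ∏ i, α i x (fun _ => I (τ i)) := by
  induction q with
  | zero => simp [wedgeList]
  | succ q ih =>
    rw [wedgeList, wedgeF_antisymmetrization _ _ x 1
      (fun K => ∏ i : Fin q, α i.castSucc x (fun _ => K i))
      (fun K => by rw [ih, one_mul])]
    simp only [Nat.factorial_one, Nat.cast_one, inv_one, mul_one, one_mul]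
    refine Finset.sum_congr rfl fun σ _ => ?_
    rw [Fin.prod_univ_castSucc]
    congr 2
    refine congrArg _ (funext fun j => ?_)
    rw [Subsingleton.elim j 0]
    rfl

/-- Pairing with a decomposable form is evaluation on its factors. -/
theorem pairF_wedgeList {N q : ℕ} (α : Fin q → Form N 1) (P : Form N q) (x : Pt N)
    (hP : ∀ (I : Fin q → Fin N) (σ : Equiv.Perm (Fin q)),
      P x (I ∘ σ) = ((Equiv.Perm.sign σ : ℤ) : ℝ) * P x I) :
    pairF (wedgeList q α) P x = ∑ I : Fin q → Fin N, (∏ i, α i x (fun _ => I i)) * P x I := by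
  have key : ∀ τ : Equiv.Perm (Fin q),
      ∑ I : Fin q → Fin N, ((Equiv.Perm.sign τ : ℤ) : ℝ) * (∏ i, α i x (fun _ => I (τ i))) *
        P x I = ∑ I : Fin q → Fin N, (∏ i, α i x (fun _ => I i)) * P x I := by
    intro τ
    rw [← Equiv.sum_comp (Equiv.arrowCongr τ.symm (Equiv.refl (Fin N)))
      (fun I : Fin q → Fin N => (∏ i, α i x (fun _ => I i)) * P x I)]
    refine Finset.sum_congr rfl fun I _ => ?_
    have : (Equiv.arrowCongr τ.symm (Equiv.refl (Fin N))) I = I ∘ τ := rfl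
    rw [this, hP]
    simp only [Function.comp_apply]
    ring
  have hq : (q.factorial : ℝ) ≠ 0 := by positivity
  simp only [pairF, wedgeList_eq_sum_perm, Finset.sum_mul]
  rw [Finset.sum_comm, Finset.sum_congr rfl fun τ _ => key τ]
  simp only [Finset.sum_const, Finset.card_univ, Fintype.card_perm, Fintype.card_fin,
    nsmul_eq_mul]
  field_simp

/-- The splitting of `Fin (2 * m)` into `m` consecutive pairs. -/
def pairEquiv (m : ℕ) : Fin m × Fin 2 ≃ Fin (2 * m) :=
  finProdFinEquiv.trans (finCongr (mul_comm m 2))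

theorem pairEquiv_val {m : ℕ} (a : Fin m × Fin 2) :
    (pairEquiv m a : ℕ) = a.2 + 2 * a.1 := by
  simp [pairEquiv]

theorem wpow_eq_sum_perm {N : ℕ} (ω : Form N 2) (m : ℕ) (x : Pt N) (I : Fin (2 * m) → Fin N) :
    wpow ω m x I = (2⁻¹ : ℝ) ^ m * ∑ σ : Equiv.Perm (Fin (2 * m)),
      ((Equiv.Perm.sign σ : ℤ) : ℝ) *
        ∏ j, ω x ![I (σ (pairEquiv m (j, 0))), I (σ (pairEquiv m (j, 1)))] := by
  induction m with
  | zero =>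
    have : IsEmpty (Fin (2 * 0)) := inferInstanceAs (IsEmpty (Fin 0))
    simp [wpow]
  | succ m ih =>
    rw [wpow, wedgeF_antisymmetrization _ _ x ((2⁻¹ : ℝ) ^ m)
      (fun K => ∏ j, ω x ![K (pairEquiv m (j, 0)), K (pairEquiv m (j, 1))]) ih]
    rw [pow_succ]
    simp only [Nat.factorial_two, Nat.cast_ofNat]
    congr 1
    refine Finset.sum_congr rfl fun σ _ => ?_
    rw [Fin.prod_univ_castSucc]
    have h : ∀ (j : Fin m) (s : Fin 2),
        pairEquiv (m + 1) (j.castSucc, s) = Fin.castAdd 2 (pairEquiv m (j, s)) := by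
      intro j s
      ext
      simp [pairEquiv_val]
    have h' : ∀ s : Fin 2, pairEquiv (m + 1) (Fin.last m, s) = Fin.natAdd (2 * m) s := by
      intro s
      ext
      simp [pairEquiv_val, add_comm]
    simp only [h, h']
    congr 3
    funext s
    fin_cases s <;> rfl

theorem wpow_comp_perm {N : ℕ} (ω : Form N 2) (m : ℕ) (x : Pt N) (I : Fin (2 * m) → Fin N)
    (τ : Equiv.Perm (Fin (2 * m))) :
    wpow ω m x (I ∘ τ) = ((Equiv.Perm.sign τ : ℤ) : ℝ) * wpow ω m x I := by
  rw [wpow_eq_sum_perm, wpow_eq_sum_perm, mul_left_comm]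
  congr 1
  rw [Finset.mul_sum, ← Equiv.sum_comp (Equiv.mulLeft τ) fun σ : Equiv.Perm (Fin (2 * m)) =>
    ((Equiv.Perm.sign τ : ℤ) : ℝ) * (((Equiv.Perm.sign σ : ℤ) : ℝ) *
      ∏ j, ω x ![I (σ (pairEquiv m (j, 0))), I (σ (pairEquiv m (j, 1)))])]
  refine Finset.sum_congr rfl fun σ _ => ?_
  simp only [Equiv.coe_mulLeft, Equiv.Perm.sign_mul, Units.val_mul, Int.cast_mul,
    Equiv.Perm.mul_apply, Function.comp_apply]
  rw [← mul_assoc, ← mul_assoc, sign_mul_sign_cast, one_mul]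

/-- `m!` times the Pfaffian of `G`, up to a power of two: the antisymmetrized product of the
entries of `G` at consecutive pairs of indices. -/
def pairSum (m : ℕ) (G : Fin (2 * m) → Fin (2 * m) → ℝ) : ℝ :=
  ∑ σ : Equiv.Perm (Fin (2 * m)), ((Equiv.Perm.sign σ : ℤ) : ℝ) *
    ∏ j, G (σ (pairEquiv m (j, 0))) (σ (pairEquiv m (j, 1)))

theorem sum_prod_mul_prod_pairs {N m : ℕ} (β : Fin (2 * m) → Fin N → ℝ)
    (L : Fin N → Fin N → ℝ) :
    ∑ I : Fin (2 * m) → Fin N, (∏ i, β i (I i)) *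
      ∏ j, L (I (pairEquiv m (j, 0))) (I (pairEquiv m (j, 1))) =
    ∏ j, ∑ a, ∑ b, β (pairEquiv m (j, 0)) a * L a b * β (pairEquiv m (j, 1)) b := by
  have h : ∀ j : Fin m,
      ∑ a, ∑ b, β (pairEquiv m (j, 0)) a * L a b * β (pairEquiv m (j, 1)) b =
      ∑ v : Fin 2 → Fin N,
        β (pairEquiv m (j, 0)) (v 0) * L (v 0) (v 1) * β (pairEquiv m (j, 1)) (v 1) := by
    intro j
    rw [← Equiv.sum_comp (finTwoArrowEquiv (Fin N)).symm, Fintype.sum_prod_type]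
    simp [finTwoArrowEquiv]
  simp only [h]
  rw [Finset.prod_univ_sum, Fintype.piFinset_univ,
    ← Equiv.sum_comp ((Equiv.arrowCongr (pairEquiv m).symm (Equiv.refl (Fin N))).trans
      (Equiv.curry _ _ _))]
  refine Finset.sum_congr rfl fun I _ => ?_
  rw [← Equiv.prod_comp (pairEquiv m), Fintype.prod_prod_type, ← Finset.prod_mul_distrib]
  refine Finset.prod_congr rfl fun j _ => ?_
  simp [Function.curry]
  ring

/-- Pairing a decomposable form with a power of a bivector only involves the values of the
bivector on the factors. -/
theorem pairF_wedgeList_wpow {N m : ℕ} (α : Fin (2 * m) → Form N 1) (ω : Form N 2) (c : ℝ)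
    (x : Pt N) :
    pairF (wedgeList (2 * m) α) (smulF c (wpow ω m)) x = c * ((2⁻¹ : ℝ) ^ m *
      pairSum m fun i j => ∑ a, ∑ b, α i x (fun _ => a) * ω x ![a, b] * α j x (fun _ => b)) := by
  rw [pairF_wedgeList _ _ _ fun I σ => by
    simp only [smulF, wpow_comp_perm]
    ring]
  simp only [smulF, wpow_eq_sum_perm, pairSum, Finset.mul_sum]
  rw [Finset.sum_comm]
  refine Finset.sum_congr rfl fun σ _ => ?_
  rw [← sum_prod_mul_prod_pairs (fun i a => α (σ i) x fun _ => a) (fun a b => ω x ![a, b]),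
    ← Equiv.sum_comp (Equiv.arrowCongr σ (Equiv.refl (Fin N)))]
  simp only [Finset.mul_sum]
  refine Finset.sum_congr rfl fun I _ => ?_
  have h1 : ∀ i, (Equiv.arrowCongr σ (Equiv.refl (Fin N))) I (σ i) = I i := fun i => by simp
  rw [← Equiv.prod_comp σ]
  simp only [h1]
  ring

/-- The matrix of the standard bivector `∑ ∂_{2j} ∧ ∂_{2j+1}`. -/
def stdBivector (n : ℕ) : Matrix (Fin (2 * n)) (Fin (2 * n)) ℝ :=
  (Matrix.blockDiagonal fun _ : Fin n => !![(0 : ℝ), 1; -1, 0]).submatrix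
    ((pairEquiv n).symm.trans (Equiv.prodComm _ _)) ((pairEquiv n).symm.trans (Equiv.prodComm _ _))

theorem stdBivector_pairEquiv {n : ℕ} (a b : Fin n × Fin 2) :
    stdBivector n (pairEquiv n a) (pairEquiv n b) =
      if a.1 = b.1 then !![(0 : ℝ), 1; -1, 0] a.2 b.2 else 0 := by
  simp [stdBivector, Matrix.blockDiagonal_apply]

theorem det_stdBivector (n : ℕ) : (stdBivector n).det = 1 := by
  rw [stdBivector, Matrix.det_submatrix_equiv_self, Matrix.det_blockDiagonal]
  simp [Matrix.det_fin_two]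

theorem stdBivector_transpose (n : ℕ) : (stdBivector n).transpose = -stdBivector n := by
  ext i j
  obtain ⟨a, rfl⟩ := (pairEquiv n).surjective i
  obtain ⟨b, rfl⟩ := (pairEquiv n).surjective j
  simp only [Matrix.transpose_apply, Matrix.neg_apply, stdBivector_pairEquiv, eq_comm (a := b.1)]
  obtain ⟨a1, a2⟩ := a
  obtain ⟨b1, b2⟩ := b
  split_ifs
  · fin_cases a2 <;> fin_cases b2 <;> simp
  · simp

theorem stdBivector_castLE {m n : ℕ} (h : 2 * m ≤ 2 * n) (i j : Fin (2 * m)) :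
    stdBivector n (Fin.castLE h i) (Fin.castLE h j) = stdBivector m i j := by
  obtain ⟨a, rfl⟩ := (pairEquiv m).surjective i
  obtain ⟨b, rfl⟩ := (pairEquiv m).surjective j
  have hc : ∀ a : Fin m × Fin 2, Fin.castLE h (pairEquiv m a) =
      pairEquiv n (Fin.castLE (by omega) a.1, a.2) := by
    intro a
    ext
    simp [pairEquiv_val]
  rw [hc, hc, stdBivector_pairEquiv, stdBivector_pairEquiv]
  simp

/-- A permutation preserving the standard pairs contributes a nonnegative term to the
Pfaffian sum of the standard bivector; all other permutations contribute zero. -/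
theorem sign_mul_prod_pairs_nonneg {m : ℕ} (σ : Equiv.Perm (Fin m × Fin 2)) :
    0 ≤ ((Equiv.Perm.sign σ : ℤ) : ℝ) *
      ∏ j, if (σ (j, 0)).1 = (σ (j, 1)).1 then
        !![(0 : ℝ), 1; -1, 0] (σ (j, 0)).2 (σ (j, 1)).2 else 0 := by
  by_cases hσ : ∀ j, (σ (j, 0)).1 = (σ (j, 1)).1
  swap
  · push Not at hσ
    obtain ⟨j, hj⟩ := hσ
    rw [Finset.prod_eq_zero (Finset.mem_univ j) (if_neg hj), mul_zero]
  have hfst : ∀ j s, (σ (j, s)).1 = (σ (j, 0)).1 := by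
    intro j s
    fin_cases s
    · rfl
    · exact (hσ j).symm
  have hsurj : Function.Surjective fun j => (σ (j, 0)).1 := by
    intro a
    obtain ⟨⟨j, s⟩, hjs⟩ := σ.surjective (a, 0)
    exact ⟨j, (hfst j s).symm.trans (congrArg Prod.fst hjs)⟩
  let π : Equiv.Perm (Fin m) :=
    Equiv.ofBijective _ (Finite.surjective_iff_bijective.1 hsurj)
  have hinj : ∀ j, Function.Injective fun s => (σ (j, s)).2 := by
    intro j s t hst
    have : σ (j, s) = σ (j, t) := Prod.ext ((hfst j s).trans (hfst j t).symm) hst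
    exact (Prod.ext_iff.1 (σ.injective this)).2
  let ρ : Fin m → Equiv.Perm (Fin 2) := fun j =>
    Equiv.ofBijective _ (Finite.injective_iff_bijective.1 (hinj j))
  have hdecomp : σ = Equiv.prodCongrLeft (fun _ : Fin 2 => π) * Equiv.prodCongrRight ρ := by
    ext1 ⟨j, s⟩
    exact Prod.ext (hfst j s) rfl
  have hsign : Equiv.Perm.sign σ = ∏ j, Equiv.Perm.sign (ρ j) := by
    rw [hdecomp, Equiv.Perm.sign_mul, Equiv.Perm.sign_prodCongrRight,
      Equiv.Perm.sign_prodCongrLeft]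
    simp
  have hentry : ∀ τ : Equiv.Perm (Fin 2),
      !![(0 : ℝ), 1; -1, 0] (τ 0) (τ 1) = ((Equiv.Perm.sign τ : ℤ) : ℝ) := by
    intro τ
    have hτ : τ = 1 ∨ τ = Equiv.swap 0 1 := by
      revert τ
      decide
    rcases hτ with rfl | rfl <;> simp
  have hterm : ∀ j, (if (σ (j, 0)).1 = (σ (j, 1)).1 then
      !![(0 : ℝ), 1; -1, 0] (σ (j, 0)).2 (σ (j, 1)).2 else 0) =
      ((Equiv.Perm.sign (ρ j) : ℤ) : ℝ) := by
    intro j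
    rw [if_pos (hσ j), ← hentry]
    rfl
  rw [hsign, Finset.prod_congr rfl fun j _ => hterm j]
  push_cast
  exact mul_self_nonneg _

theorem pairSum_stdBivector_pos (m : ℕ) : 0 < pairSum m (stdBivector m) := by
  have hnonneg : ∀ σ : Equiv.Perm (Fin (2 * m)), 0 ≤ ((Equiv.Perm.sign σ : ℤ) : ℝ) *
      ∏ j, stdBivector m (σ (pairEquiv m (j, 0))) (σ (pairEquiv m (j, 1))) := by
    intro σ
    have h := sign_mul_prod_pairs_nonneg ((pairEquiv m).symm.permCongr σ)
    rw [Equiv.Perm.sign_permCongr] at h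
    simp only [← stdBivector_pairEquiv] at h
    simpa [Equiv.permCongr_apply] using h
  refine Finset.sum_pos' (fun σ _ => hnonneg σ) ⟨1, Finset.mem_univ _, ?_⟩
  simp [stdBivector_pairEquiv]

theorem pairSum_const_mul {m : ℕ} (s : ℝ) (G : Fin (2 * m) → Fin (2 * m) → ℝ) :
    pairSum m (fun i j => s * G i j) = s ^ m * pairSum m G := by
  simp only [pairSum, Finset.prod_mul_distrib, Finset.prod_const, Finset.card_univ,
    Fintype.card_fin, Finset.mul_sum]
  refine Finset.sum_congr rfl fun σ _ => ?_
  ring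

theorem altArr_of_antisymm {N : ℕ} (L : Matrix (Fin N) (Fin N) ℝ) (hL : L.transpose = -L) :
    AltArr fun I : Fin 2 → Fin N => L (I 0) (I 1) := by
  have h : ∀ a b, L b a = -L a b := fun a b => congrFun (congrFun hL a) b
  refine ⟨fun I σ => ?_, fun I hI => ?_⟩
  · have hσ : σ = 1 ∨ σ = Equiv.swap 0 1 := by
      revert σ
      decide
    rcases hσ with rfl | rfl
    · simp
    · simp [h (I 0) (I 1)]
  · have h01 : I 0 = I 1 := by
      by_contra hne
      refine hI fun s t hst => ?_
      fin_cases s <;> fin_cases t <;> simp_all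
    have := h (I 0) (I 0)
    simp only [← h01]
    linarith

theorem exists_matrix_extending_rows {q N : ℕ} (h : q ≤ N) (v : Fin q → Fin N → ℝ)
    (hv : LinearIndependent ℝ v) :
    ∃ A : Matrix (Fin N) (Fin N) ℝ, A.det ≠ 0 ∧ ∀ i, A (Fin.castLE h i) = v i := by
  let b := Module.Basis.sumExtend hv
  have : Fintype (Fin q ⊕ Module.Basis.sumExtendIndex hv) :=
    FiniteDimensional.fintypeBasisIndex b
  have : Fintype (Module.Basis.sumExtendIndex hv) :=
    Fintype.ofInjective (Sum.inr : _ → Fin q ⊕ Module.Basis.sumExtendIndex hv) Sum.inr_injective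
  have hcard : Fintype.card (Module.Basis.sumExtendIndex hv) = N - q := by
    have h1 := Module.finrank_eq_nat_card_basis b
    rw [Nat.card_sum] at h1
    simp only [Module.finrank_fin_fun, Nat.card_eq_fintype_card, Fintype.card_fin] at h1
    omega
  let e : Fin N ≃ Fin q ⊕ Module.Basis.sumExtendIndex hv :=
    ((finCongr (by omega : N = q + (N - q))).trans finSumFinEquiv.symm).trans
      (Equiv.sumCongr (Equiv.refl _) (Fintype.equivFinOfCardEq hcard).symm)
  refine ⟨Matrix.of fun i => b (e i), ?_, fun i => ?_⟩
  · rw [← isUnit_iff_ne_zero, ← Matrix.isUnit_iff_isUnit_det,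
      ← Matrix.linearIndependent_rows_iff_isUnit]
    exact b.linearIndependent.comp e e.injective
  · have he : e (Fin.castLE h i) = Sum.inl i := by
      have : finCongr (by omega : N = q + (N - q)) (Fin.castLE h i) = Fin.castAdd (N - q) i := rfl
      simp [e, this]
    change b (e (Fin.castLE h i)) = v i
    rw [he]
    simp only [b, Module.Basis.sumExtend, Module.Basis.reindex_apply, Module.Basis.coe_extend]
    rfl

theorem contDiffOn_det {E ι : Type*} [NormedAddCommGroup E] [NormedSpace ℝ E] [Fintype ι]
    [DecidableEq ι] {A : E → Matrix ι ι ℝ} {s : Set E} {r : WithTop ℕ∞}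
    (hA : ∀ i j, ContDiffOn ℝ r (fun x => A x i j) s) :
    ContDiffOn ℝ r (fun x => (A x).det) s := by
  simp only [Matrix.det_apply']
  exact ContDiffOn.sum fun σ _ => contDiffOn_const.mul (contDiffOn_prod fun i _ => hA _ _)

theorem contDiffOn_matrix_inv {E ι : Type*} [NormedAddCommGroup E] [NormedSpace ℝ E]
    [Fintype ι] [DecidableEq ι] {A : E → Matrix ι ι ℝ} {s : Set E} {r : WithTop ℕ∞}
    (hA : ∀ i j, ContDiffOn ℝ r (fun x => A x i j) s) (hdet : ∀ x ∈ s, (A x).det ≠ 0) (i j : ι) :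
    ContDiffOn ℝ r (fun x => (A x)⁻¹ i j) s := by
  simp only [Matrix.inv_def, Matrix.smul_apply, Ring.inverse_eq_inv', smul_eq_mul,
    Matrix.adjugate_apply]
  refine ((contDiffOn_det hA).inv hdet).mul (contDiffOn_det fun a b => ?_)
  by_cases hab : a = j
  · subst hab
    simp only [Matrix.updateRow_self]
    exact contDiffOn_const
  · simp only [Matrix.updateRow_ne hab]
    exact hA a b

/-!
STATEMENT 2.  Given `f₁,…,f_{2(n-k)}` smooth on an open `M ⊆ ℝ^{2n}` with
`df₁,…,df_{2(n-k)}` linearly independent at `p ∈ M`, there are an open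
neighborhood `U ⊆ M` of `p` and a bivector field `Λ₀` on `U`, nondegenerate at
every point of `U`, with `⟨df₁∧⋯∧df_{2(n-k)}, Λ₀^{n-k}/(n-k)!⟩ = 1` on `U`.
-/
theorem exists_nondegenerate_bivector_with_unit_pairing
    (n k : ℕ) (hn : 1 ≤ n) (hk1 : 1 ≤ k) (hk2 : k ≤ n - 1)
    (M : Set (Pt (2 * n))) (hMo : IsOpen M) (hMne : M.Nonempty)
    (f : Fin (2 * (n - k)) → Pt (2 * n) → ℝ)
    (hf : ∀ i, ContDiffOn ℝ (⊤ : ℕ∞) (f i) M)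
    (p : Pt (2 * n)) (hp : p ∈ M)
    (hind : LinearIndependent ℝ fun i => grad (f i) p) :
    ∃ U : Set (Pt (2 * n)), IsOpen U ∧ p ∈ U ∧ U ⊆ M ∧
      ∃ Λ₀ : Form (2 * n) 2, IsFormOn Λ₀ U ∧
        (∀ x ∈ U, (mat2 Λ₀ x).det ≠ 0) ∧
        ∀ x ∈ U,
          pairF (wedgeList (2 * (n - k)) fun i => dF (f i))
            (smulF (((n - k).factorial : ℝ)⁻¹) (wpow Λ₀ (n - k))) x = 1 := by
  have hm0 : n - k ≠ 0 := by omega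
  have hmn : 2 * (n - k) ≤ 2 * n := by omega
  generalize n - k = m at *
  obtain ⟨A₀, hA₀det, hA₀⟩ := exists_matrix_extending_rows hmn _ hind
  let A : Pt (2 * n) → Matrix (Fin (2 * n)) (Fin (2 * n)) ℝ := fun x =>
    Matrix.of fun i => if h : (i : ℕ) < 2 * m then grad (f ⟨i, h⟩) x else A₀ i
  have hArow : ∀ x i, A x (Fin.castLE hmn i) = grad (f i) x := fun x i => by
    ext j
    simp [A, Matrix.of_apply]
  have hAp : A p = A₀ := by
    refine funext fun i => ?_
    by_cases h : (i : ℕ) < 2 * m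
    · exact (hArow p ⟨i, h⟩).trans (hA₀ ⟨i, h⟩).symm
    · ext j
      simp [A, h]
  have hAsmooth : ∀ i j, ContDiffOn ℝ (⊤ : ℕ∞) (fun x => A x i j) M := by
    intro i j
    by_cases h : (i : ℕ) < 2 * m
    · simp only [A, Matrix.of_apply, h, dite_true, grad, pd]
      exact ((hf ⟨i, h⟩).fderiv_of_isOpen hMo (by simp)).clm_apply contDiffOn_const
    · simp only [A, Matrix.of_apply, h, dite_false]
      exact contDiffOn_const
  let U := M ∩ (fun x => (A x).det) ⁻¹' {0}ᶜ
  have hUdet : ∀ x ∈ U, (A x).det ≠ 0 := fun x hx => hx.2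
  have hUM : U ⊆ M := Set.inter_subset_left
  have hUo : IsOpen U := (contDiffOn_det hAsmooth).continuousOn.isOpen_inter_preimage hMo
    isOpen_compl_singleton
  obtain ⟨s, hs0, hs⟩ : ∃ s : ℝ, s ≠ 0 ∧
      ((m.factorial : ℝ)⁻¹) * ((2⁻¹ : ℝ) ^ m * (s ^ m * pairSum m (stdBivector m))) = 1 := by
    have hc : 0 < (m.factorial : ℝ)⁻¹ * ((2⁻¹ : ℝ) ^ m * pairSum m (stdBivector m)) := by
      have := pairSum_stdBivector_pos m
      positivity
    set c := (m.factorial : ℝ)⁻¹ * ((2⁻¹ : ℝ) ^ m * pairSum m (stdBivector m))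
    refine ⟨c⁻¹ ^ ((m : ℝ)⁻¹), by positivity, ?_⟩
    rw [Real.rpow_inv_natCast_pow (by positivity) hm0, mul_left_comm _ c⁻¹,
      mul_left_comm _ c⁻¹]
    exact inv_mul_cancel₀ hc.ne'
  let L : Pt (2 * n) → Matrix (Fin (2 * n)) (Fin (2 * n)) ℝ := fun x =>
    s • ((A x)⁻¹ * stdBivector n * ((A x)⁻¹).transpose)
  have hLdet : ∀ x ∈ U, (L x).det ≠ 0 := by
    intro x hx
    have : ((A x)⁻¹).det ≠ 0 := by
      rw [Matrix.det_nonsing_inv, Ring.inverse_eq_inv']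
      exact inv_ne_zero (hUdet x hx)
    simp only [L, Matrix.det_smul, Matrix.det_mul, Matrix.det_transpose, det_stdBivector]
    positivity
  have hLanti : ∀ x, (L x).transpose = -L x := by
    intro x
    simp only [L, Matrix.transpose_smul, Matrix.transpose_mul, Matrix.transpose_transpose,
      stdBivector_transpose, Matrix.neg_mul, Matrix.mul_neg, smul_neg, Matrix.mul_assoc]
  have hconj : ∀ x ∈ U, A x * L x * (A x).transpose = s • stdBivector n := by
    intro x hx
    have hu : IsUnit (A x).det := isUnit_iff_ne_zero.2 (hUdet x hx)
    have hT : ((A x)⁻¹).transpose * (A x).transpose = 1 := by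
      rw [← Matrix.transpose_mul, Matrix.mul_nonsing_inv _ hu, Matrix.transpose_one]
    simp only [L, Matrix.mul_smul, Matrix.smul_mul]
    rw [Matrix.mul_assoc, Matrix.mul_assoc, Matrix.mul_assoc, hT, Matrix.mul_one,
      ← Matrix.mul_assoc, Matrix.mul_nonsing_inv _ hu, Matrix.one_mul]
  refine ⟨U, hUo, ⟨hp, by simpa [hAp] using hA₀det⟩, hUM, fun x I => L x (I 0) (I 1),
    ⟨fun x _ => altArr_of_antisymm _ (hLanti x), fun I => ?_⟩, fun x hx => hLdet x hx,
    fun x hx => ?_⟩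
  · have hinv := contDiffOn_matrix_inv (fun i j => (hAsmooth i j).mono hUM) hUdet
    simp only [L, Matrix.smul_apply, smul_eq_mul, Matrix.mul_apply, Matrix.transpose_apply]
    exact contDiffOn_const.mul (ContDiffOn.sum fun b _ =>
      (ContDiffOn.sum fun a _ => (hinv _ _).mul contDiffOn_const).mul (hinv _ _))
  · rw [pairF_wedgeList_wpow]
    have hG : (fun i j => ∑ a, ∑ b, dF (f i) x (fun _ => a) * L x (![a, b] 0) (![a, b] 1) *
        dF (f j) x (fun _ => b)) = fun i j => s * stdBivector m i j := by
      funext i j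
      have h := congrFun (congrFun (hconj x hx) (Fin.castLE hmn i)) (Fin.castLE hmn j)
      rw [Matrix.smul_apply, stdBivector_castLE, smul_eq_mul] at h
      rw [← h]
      simp only [Matrix.mul_apply, Matrix.transpose_apply, hArow, Finset.sum_mul]
      rw [Finset.sum_comm]
      rfl
    rw [hG]
    exact (congrArg _ (congrArg _ (pairSum_const_mul s _))).trans hs

end
end Damianou
end

section
/- Let ω₀ be an almost symplectic structure on M, let σ be a differential 2-form on M, and let Λ = Λ₀^#(σ) be the bivector field defined by Λ(α,β) = σ(Λ₀^#(α), Λ₀^#(β)) for all 1-forms α, β. Then Λ is a Poisson tensor on M if and only if 2 σ∧δ(σ) = δ(σ∧σ), where δ = *∘d∘* is the codifferential associated with ω₀. -/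
namespace Damianou

noncomputable section

theorem altArr_of_perm {N p : ℕ} {f : (Fin p → Fin N) → ℝ}
    (hf : ∀ (I : Fin p → Fin N) (σ : Equiv.Perm (Fin p)),
      f (I ∘ σ) = ((Equiv.Perm.sign σ : ℤ) : ℝ) * f I) : AltArr f := by
  refine ⟨hf, fun I hI => ?_⟩
  simp only [Function.Injective, not_forall] at hI
  obtain ⟨i, j, hij, hne⟩ := hI
  have h := hf I (Equiv.swap i j)
  have h2 : I ∘ Equiv.swap i j = I := by
    funext t
    simp only [Function.comp_apply, Equiv.swap_apply_def]
    split_ifs with h1 h1 <;> simp_all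
  rw [h2, Equiv.Perm.sign_swap hne] at h
  push_cast at h
  linarith

theorem sign_mul_sign_real {p : ℕ} (σ : Equiv.Perm (Fin p)) :
    ((Equiv.Perm.sign σ : ℤ) : ℝ) * ((Equiv.Perm.sign σ : ℤ) : ℝ) = 1 := by
  rcases Int.units_eq_one_or (Equiv.Perm.sign σ) with h | h <;> simp [h]

theorem exists_perm_of_range_subset {X : Type*} {q : ℕ} {J J₀ : Fin q → X}
    (hJ : J.Injective) (h : ∀ i, ∃ k, J₀ k = J i) :
    ∃ π : Equiv.Perm (Fin q), J = J₀ ∘ π := by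
  choose k hk using h
  have hinj : k.Injective := fun a b hab => hJ (by rw [← hk a, ← hk b, hab])
  exact ⟨Equiv.ofBijective k (Finite.injective_iff_bijective.1 hinj), funext fun i => (hk i).symm⟩

/-- A sum over index tuples supported on the rearrangements of an injective tuple. -/
theorem sum_eq_sum_perm {X : Type*} [Fintype X] {q : ℕ} {J₀ : Fin q → X} (hJ₀ : J₀.Injective)
    (g : (Fin q → X) → ℝ) (hg : ∀ J, g J ≠ 0 → ∃ π : Equiv.Perm (Fin q), J = J₀ ∘ π) :
    ∑ J, g J = ∑ π : Equiv.Perm (Fin q), g (J₀ ∘ π) := by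
  classical
  symm
  refine Fintype.sum_of_injective (fun π : Equiv.Perm (Fin q) => J₀ ∘ π) ?_ _ _ ?_ fun _ => rfl
  · intro a b hab
    ext i
    exact congrArg _ (hJ₀ (congrFun hab i))
  · intro J hJ
    by_contra hne
    obtain ⟨π, rfl⟩ := hg J hne
    exact hJ ⟨π, rfl⟩

/-- The Levi-Civita symbol. -/
def leviCivita {N : ℕ} (I : Fin N → Fin N) : ℝ :=
  ((1 : Matrix (Fin N) (Fin N) ℝ).submatrix I id).det

theorem altArr_leviCivita {N : ℕ} : AltArr (leviCivita (N := N)) :=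
  altArr_of_perm fun I σ => by
    unfold leviCivita
    rw [← Matrix.det_permute σ, Matrix.submatrix_submatrix]
    rfl

theorem leviCivita_id {N : ℕ} : leviCivita (id : Fin N → Fin N) = 1 := by
  simp [leviCivita]

theorem injective_of_leviCivita_ne_zero {N : ℕ} {I : Fin N → Fin N} (h : leviCivita I ≠ 0) :
    I.Injective := by
  by_contra hI
  exact h (altArr_leviCivita.2 I hI)

/-- A top degree alternating array is a multiple of the Levi-Civita symbol. -/
theorem AltArr.eq_leviCivita {N : ℕ} {f : (Fin N → Fin N) → ℝ} (hf : AltArr f)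
    (I : Fin N → Fin N) : f I = f id * leviCivita I := by
  by_cases hI : I.Injective
  · obtain ⟨π, rfl⟩ := exists_perm_of_range_subset (J₀ := id) hI (fun i => ⟨_, rfl⟩)
    rw [hf.1, altArr_leviCivita.1, leviCivita_id]
    ring
  · rw [hf.2 I hI, altArr_leviCivita.2 I hI, mul_zero]

theorem leviCivita_mul_self {N : ℕ} {I : Fin N → Fin N} (hI : I.Injective) :
    leviCivita I * leviCivita I = 1 := by
  obtain ⟨π, rfl⟩ := exists_perm_of_range_subset (J₀ := id) hI (fun i => ⟨_, rfl⟩)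
  rw [altArr_leviCivita.1, leviCivita_id, mul_one, sign_mul_sign_real]

/-- Concatenation of index blocks. -/
def cat {X : Type*} {p q N : ℕ} (h : p + q = N) (u : Fin p → X) (v : Fin q → X) : Fin N → X :=
  Fin.append u v ∘ Fin.cast h.symm

theorem catIdx_eq_cat {N a b : ℕ} (h : a + (b - a) = b) (u : Fin a → Fin N)
    (v : Fin (b - a) → Fin N) : catIdx u v = cat h u v := by
  funext t
  by_cases ht : (t : ℕ) < a <;> simp [catIdx, cat, Fin.append, Fin.addCases, ht] <;> rfl

theorem cat_apply_lt {X : Type*} {p q N : ℕ} (h : p + q = N) (u : Fin p → X) (v : Fin q → X)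
    (t : Fin N) (ht : (t : ℕ) < p) : cat h u v t = u ⟨t, ht⟩ := by
  simp [cat, Fin.append, Fin.addCases, ht]
  rfl

theorem cat_apply_ge {X : Type*} {p q N : ℕ} (h : p + q = N) (u : Fin p → X) (v : Fin q → X)
    (t : Fin N) (ht : p ≤ (t : ℕ)) : cat h u v t = v ⟨t - p, by omega⟩ := by
  simp [cat, Fin.append, Fin.addCases, ht.not_gt]
  rfl

theorem sum_cat {X : Type*} [Fintype X] {p q N : ℕ} (h : p + q = N) (F : (Fin N → X) → ℝ) :
    ∑ I, F I = ∑ u, ∑ v, F (cat h u v) := by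
  subst h
  rw [← Fintype.sum_prod_type', ← (Fin.appendEquiv p q).sum_comp]
  rfl

theorem prod_cat {X Y : Type*} {p q N : ℕ} (h : p + q = N) (L : X → Y → ℝ) (u : Fin p → X)
    (v : Fin q → X) (u' : Fin p → Y) (v' : Fin q → Y) :
    ∏ t, L (cat h u v t) (cat h u' v' t) = (∏ t, L (u t) (u' t)) * ∏ t, L (v t) (v' t) := by
  subst h
  simp [cat, Fin.prod_univ_add]

theorem AltArr.cat_left {M p q N : ℕ} (h : p + q = N) {f : (Fin N → Fin M) → ℝ}
    (hf : AltArr f) (v : Fin q → Fin M) : AltArr (fun u : Fin p → Fin M => f (cat h u v)) := by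
  refine altArr_of_perm fun u ρ => ?_
  subst h
  have : cat rfl (u ∘ ρ) v = cat rfl u v ∘
      (finSumFinEquiv.permCongr (Equiv.Perm.sumCongr ρ (1 : Equiv.Perm (Fin q)))) := by
    funext t
    induction t using Fin.addCases <;> simp [cat, Equiv.permCongr_apply]
  rw [this, hf.1, Equiv.Perm.sign_permCongr, Equiv.Perm.sign_sumCongr]
  simp

theorem injective_right_of_cat {X : Type*} {p q N : ℕ} (h : p + q = N) {u : Fin p → X}
    {v : Fin q → X} (hc : (cat h u v).Injective) : v.Injective := by
  subst h
  intro a b hab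
  have := @hc (Fin.natAdd p a) (Fin.natAdd p b) (by simpa [cat] using hab)
  simpa using this

theorem injective_left_of_cat {X : Type*} {p q N : ℕ} (h : p + q = N) {u : Fin p → X}
    {v : Fin q → X} (hc : (cat h u v).Injective) : u.Injective := by
  subst h
  intro a b hab
  have := @hc (Fin.castAdd q a) (Fin.castAdd q b) (by simpa [cat] using hab)
  simpa using this

theorem ne_of_cat_injective {X : Type*} {p q N : ℕ} (h : p + q = N) {u : Fin p → X}
    {v : Fin q → X} (hc : (cat h u v).Injective) (i : Fin p) (j : Fin q) : u i ≠ v j := by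
  subst h
  intro hab
  have := @hc (Fin.castAdd q i) (Fin.natAdd p j) (by simpa [cat] using hab)
  rw [Fin.ext_iff] at this
  simp at this
  omega

theorem mem_range_of_cat_injective {p q N : ℕ} (h : p + q = N) {u : Fin p → Fin N}
    {v : Fin q → Fin N} (hc : (cat h u v).Injective) (x : Fin N) :
    (∃ i, u i = x) ∨ ∃ j, v j = x := by
  subst h
  obtain ⟨t, rfl⟩ := (Finite.injective_iff_surjective.1 hc) x
  induction t using Fin.addCases with
  | left i => exact Or.inl ⟨i, by simp [cat]⟩
  | right j => exact Or.inr ⟨j, by simp [cat]⟩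

theorem exists_cat_injective {p q N : ℕ} (h : p + q = N) {u : Fin p → Fin N}
    (hu : u.Injective) : ∃ v : Fin q → Fin N, (cat h u v).Injective := by
  have hcard : (Finset.univ.image u)ᶜ.card = q := by
    rw [Finset.card_compl, Finset.card_image_of_injective _ hu]
    simp
    omega
  refine ⟨(Finset.univ.image u)ᶜ.orderEmbOfFin hcard, ?_⟩
  subst h
  refine Fin.append_injective_iff.2 ⟨hu, (Finset.orderEmbOfFin _ hcard).injective, ?_⟩
  intro i j hij
  have := Finset.orderEmbOfFin_mem _ hcard j
  rw [← hij] at this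
  simp at this

/-- Contraction of two Levi-Civita symbols against an alternating array. -/
theorem AltArr.sum_leviCivita_mul_leviCivita {p q N : ℕ} (h : p + q = N)
    {P : (Fin p → Fin N) → ℝ} (hP : AltArr P) (I' : Fin p → Fin N) :
    ∑ J : Fin q → Fin N, ∑ I, P I * (leviCivita (cat h I J) * leviCivita (cat h I' J)) =
      (p.factorial : ℝ) * q.factorial * P I' := by
  by_cases hI' : I'.Injective
  swap
  · rw [hP.2 I' hI', mul_zero]
    refine Finset.sum_eq_zero fun J _ => Finset.sum_eq_zero fun I _ => ?_
    rw [altArr_leviCivita.2 (cat h I' J) fun hc => hI' (injective_left_of_cat h hc)]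
    ring
  obtain ⟨J₀, hJ₀⟩ := exists_cat_injective h hI'
  have hinj (π : Equiv.Perm (Fin q)) : (cat h I' (J₀ ∘ π)).Injective := by
    subst h
    refine Fin.append_injective_iff.2
      ⟨hI', (injective_right_of_cat rfl hJ₀).comp π.injective, fun i j => ?_⟩
    exact ne_of_cat_injective rfl hJ₀ i (π j)
  rw [sum_eq_sum_perm (injective_right_of_cat h hJ₀)]
  · have key (π : Equiv.Perm (Fin q)) :
        ∑ I, P I * (leviCivita (cat h I (J₀ ∘ π)) * leviCivita (cat h I' (J₀ ∘ π))) =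
          p.factorial * P I' := by
      rw [sum_eq_sum_perm hI']
      · simp_rw [(altArr_leviCivita.cat_left h (J₀ ∘ π)).1, hP.1]
        have : ∀ ρ : Equiv.Perm (Fin p), ((Equiv.Perm.sign ρ : ℤ) : ℝ) * P I' *
            (((Equiv.Perm.sign ρ : ℤ) : ℝ) * leviCivita (cat h I' (J₀ ∘ π)) *
              leviCivita (cat h I' (J₀ ∘ π))) = P I' := fun ρ => by
          linear_combination P I' * sign_mul_sign_real ρ + P I' * ((Equiv.Perm.sign ρ : ℤ) : ℝ) *
            ((Equiv.Perm.sign ρ : ℤ) : ℝ) * leviCivita_mul_self (hinj π)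
        simp_rw [this]
        simp [Fintype.card_perm]
      · intro I hI
        have hc := injective_of_leviCivita_ne_zero (left_ne_zero_of_mul (right_ne_zero_of_mul hI))
        refine exists_perm_of_range_subset (injective_left_of_cat h hc) fun i => ?_
        rcases mem_range_of_cat_injective h (hinj π) (I i) with h1 | ⟨j, hj⟩
        · exact h1
        · exact absurd hj.symm (ne_of_cat_injective h hc i j)
    simp_rw [key]
    simp [Fintype.card_perm]
    ring
  · intro J hJ
    obtain ⟨I, -, hI⟩ := Finset.exists_ne_zero_of_sum_ne_zero hJ
    have hc := injective_of_leviCivita_ne_zero (right_ne_zero_of_mul (right_ne_zero_of_mul hI))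
    refine exists_perm_of_range_subset (injective_right_of_cat h hc) fun j => ?_
    rcases mem_range_of_cat_injective h hJ₀ (J j) with ⟨i, hi⟩ | h1
    · exact absurd hi (ne_of_cat_injective h hc i j)
    · exact h1

theorem finRotate_pow_val {N : ℕ} (m : ℕ) (t : Fin N) :
    ((finRotate N ^ m) t : ℕ) = (t + m) % N := by
  induction m with
  | zero => simp [Nat.mod_eq_of_lt t.isLt]
  | succ m ih =>
    cases N with
    | zero => exact t.elim0
    | succ k =>
      rw [pow_succ', Equiv.Perm.mul_apply, finRotate_apply, Fin.val_add, ih,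
        Fin.val_one', ← Nat.add_mod, add_assoc]

/-- Moving an even block past an odd one, together with one more index. -/
theorem AltArr.cat_cons_eq_neg_cat_snoc {M q r N : ℕ} (h₁ : q + 1 + r = N) (h₂ : r + 1 + q = N)
    (hq : Even q) (hr : Odd r) {f : (Fin N → Fin M) → ℝ} (hf : AltArr f) (a : Fin M)
    (J : Fin q → Fin M) (K : Fin r → Fin M) :
    f (cat h₁ (Fin.cons a J : Fin (q + 1) → Fin M) K) =
      -f (cat h₂ (Fin.snoc K a : Fin (r + 1) → Fin M) J) := by
  have hrot : cat h₂ (Fin.snoc K a : Fin (r + 1) → Fin M) J =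
      cat h₁ (Fin.cons a J : Fin (q + 1) → Fin M) K ∘ (finRotate N ^ (q + 1) : Equiv.Perm _) := by
    funext t
    have hv := finRotate_pow_val (q + 1) t
    rw [Function.comp_apply]
    have htN := t.isLt
    rcases lt_trichotomy (t : ℕ) r with ht | ht | ht
    · rw [Nat.mod_eq_of_lt (by omega)] at hv
      rw [cat_apply_lt _ _ _ _ (by omega), cat_apply_ge _ _ _ _ (by omega)]
      simp [Fin.snoc, ht, hv]
    · have hv0 : (t + (q + 1)) % N = 0 := by
        rw [show (t : ℕ) + (q + 1) = N by omega, Nat.mod_self]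
      rw [hv0] at hv
      rw [cat_apply_lt _ _ _ _ (by omega), cat_apply_lt _ _ _ _ (by omega)]
      simp [Fin.snoc, ht, hv]
    · have hv0 : (t + (q + 1)) % N = t - r := by
        rw [show (t : ℕ) + (q + 1) = (t - r) + N by omega, Nat.add_mod_right,
          Nat.mod_eq_of_lt (by omega)]
      rw [hv0] at hv
      rw [cat_apply_ge _ _ _ _ (by omega), cat_apply_lt _ _ _ _ (by omega)]
      have : (⟨((finRotate N ^ (q + 1)) t : ℕ), by omega⟩ : Fin (q + 1)) =
          Fin.succ ⟨t - (r + 1), by omega⟩ := by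
        ext
        simp [hv]
        omega
      rw [this, Fin.cons_succ]
  rw [hrot, hf.1, map_pow, sign_finRotate]
  have : Odd (N - 1) := by
    obtain ⟨k, hk⟩ := hq
    obtain ⟨l, hl⟩ := hr
    exact ⟨k + l, by omega⟩
  rw [this.neg_one_pow, (hq.add_one).neg_one_pow]
  simp

/-- Transport of a component array by a matrix acting on every index. -/
def pullArr {N p : ℕ} (L : Matrix (Fin N) (Fin N) ℝ) (f : (Fin p → Fin N) → ℝ) :
    (Fin p → Fin N) → ℝ :=
  fun J => ∑ I, f I * ∏ t, L (I t) (J t)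

theorem sharpF_eq_pullArr {N p : ℕ} (Λ : Form N 2) (ζ : Form N p) (x : Pt N)
    (J : Fin p → Fin N) : sharpF Λ p ζ x J = (-1) ^ p * pullArr (mat2 Λ x) (ζ x) J := rfl

theorem AltArr.const_mul {N p : ℕ} {f : (Fin p → Fin N) → ℝ} (hf : AltArr f) (c : ℝ) :
    AltArr fun I => c * f I :=
  altArr_of_perm fun I σ => by rw [hf.1]; ring

theorem AltArr.pullArr {N p : ℕ} {f : (Fin p → Fin N) → ℝ} (hf : AltArr f)
    (L : Matrix (Fin N) (Fin N) ℝ) : AltArr (pullArr L f) := by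
  refine altArr_of_perm fun J σ => ?_
  unfold Damianou.pullArr
  rw [← (σ.arrowCongr (Equiv.refl (Fin N))).symm.sum_comp, Finset.mul_sum]
  refine Finset.sum_congr rfl fun I _ => ?_
  have h : (σ.arrowCongr (Equiv.refl (Fin N))).symm I = I ∘ σ := rfl
  rw [h, hf.1, mul_assoc]
  congr 2
  exact Equiv.prod_comp σ fun t => L (I t) (J t)

theorem pullArr_pullArr {N p : ℕ} (L L' : Matrix (Fin N) (Fin N) ℝ)
    (f : (Fin p → Fin N) → ℝ) : pullArr L' (pullArr L f) = pullArr (L * L') f := by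
  funext J
  simp only [pullArr, Finset.sum_mul]
  rw [Finset.sum_comm]
  refine Finset.sum_congr rfl fun I _ => ?_
  simp only [Matrix.mul_apply, Finset.prod_univ_sum, Fintype.piFinset_univ, mul_assoc,
    ← Finset.mul_sum, Finset.prod_mul_distrib]

theorem pullArr_neg_one {N p : ℕ} (f : (Fin p → Fin N) → ℝ) (J : Fin p → Fin N) :
    pullArr (-1) f J = (-1) ^ p * f J := by
  unfold pullArr
  rw [Finset.sum_eq_single J]
  · simp [mul_comm]
  · intro I _ hI
    obtain ⟨t, ht⟩ := Function.ne_iff.1 hI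
    rw [Finset.prod_eq_zero (Finset.mem_univ t), mul_zero]
    simp [Matrix.one_apply_ne ht]
  · simp

theorem pullArr_injective {N p : ℕ} {L W : Matrix (Fin N) (Fin N) ℝ} (h : W * L = -1)
    {f g : (Fin p → Fin N) → ℝ} (hfg : pullArr L f = pullArr L g) : f = g := by
  have h' : L * W = -1 := by
    have h1 : (-W) * L = 1 := by rw [neg_mul, h, neg_neg]
    rw [mul_eq_one_comm, mul_neg] at h1
    rw [← h1, neg_neg]
  have := congrArg (pullArr W) hfg
  rw [pullArr_pullArr, pullArr_pullArr, h'] at this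
  funext J
  have hJ := congrFun this J
  rw [pullArr_neg_one, pullArr_neg_one] at hJ
  exact mul_left_cancel₀ (pow_ne_zero _ (by norm_num)) hJ

theorem pullArr_leviCivita {N : ℕ} (L : Matrix (Fin N) (Fin N) ℝ) (J : Fin N → Fin N) :
    pullArr L leviCivita J = L.det * leviCivita J := by
  rw [(altArr_leviCivita.pullArr L).eq_leviCivita J]
  congr 1
  unfold pullArr
  rw [sum_eq_sum_perm (J₀ := id) Function.injective_id, Matrix.det_apply']
  · refine Finset.sum_congr rfl fun σ _ => ?_
    rw [altArr_leviCivita.1, leviCivita_id]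
    simp
  · exact fun J hJ => exists_perm_of_range_subset
      (injective_of_leviCivita_ne_zero (left_ne_zero_of_mul hJ)) fun i => ⟨_, rfl⟩

theorem pullArr_sum_leviCivita {N q r : ℕ} (h : q + r = N) {L : Matrix (Fin N) (Fin N) ℝ}
    (hL : ∀ i j, L j i = -L i j) (ψ : (Fin q → Fin N) → ℝ) (K' : Fin r → Fin N) :
    pullArr L (fun K => ∑ J, pullArr L ψ J * leviCivita (cat h J K)) K' =
      (-1) ^ q * L.det * ∑ J, ψ J * leviCivita (cat h J K') := by
  have key (J' : Fin q → Fin N) : L.det * leviCivita (cat h J' K') =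
      ∑ K, ∑ J, leviCivita (cat h J K) * ((∏ t, L (J t) (J' t)) * ∏ t, L (K t) (K' t)) := by
    rw [← pullArr_leviCivita, pullArr, sum_cat h, Finset.sum_comm]
    simp only [prod_cat h fun i j => L i j]
  have hneg (J J' : Fin q → Fin N) :
      ∏ t, L (J' t) (J t) = (-1) ^ q * ∏ t, L (J t) (J' t) := by
    simp_rw [hL (J _) (J' _)]
    rw [Finset.prod_neg]
    simp
  calc pullArr L (fun K => ∑ J, pullArr L ψ J * leviCivita (cat h J K)) K'
      = ∑ K, ∑ J, ∑ J', (ψ J' * ∏ t, L (J' t) (J t)) * leviCivita (cat h J K) *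
          ∏ t, L (K t) (K' t) := by
        simp only [pullArr, Finset.sum_mul]
    _ = ∑ J', ∑ K, ∑ J, (ψ J' * ∏ t, L (J' t) (J t)) * leviCivita (cat h J K) *
          ∏ t, L (K t) (K' t) := by
        exact (Finset.sum_congr rfl fun K _ => Finset.sum_comm).trans Finset.sum_comm
    _ = (-1) ^ q * L.det * ∑ J, ψ J * leviCivita (cat h J K') := by
        rw [Finset.mul_sum]
        refine Finset.sum_congr rfl fun J' _ => ?_
        rw [show (-1) ^ q * L.det * (ψ J' * leviCivita (cat h J' K')) =
          (-1) ^ q * ψ J' * (L.det * leviCivita (cat h J' K')) by ring, key]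
        simp only [Finset.mul_sum]
        refine Finset.sum_congr rfl fun K _ => Finset.sum_congr rfl fun J _ => ?_
        rw [hneg]
        ring

theorem AltArr.sum_antisymmetrize {M m : ℕ} {g : (Fin (m + 1) → Fin M) → ℝ} (hg : AltArr g)
    (χ : Fin M → (Fin m → Fin M) → ℝ) :
    ∑ J, (∑ i : Fin (m + 1), (-1 : ℝ) ^ (i : ℕ) * χ (J i) (fun j => J (i.succAbove j))) * g J =
      (m + 1) * ∑ a, ∑ J', χ a J' * g (Fin.cons a J' : Fin (m + 1) → Fin M) := by
  simp only [Finset.sum_mul]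
  rw [Finset.sum_comm]
  have key (i : Fin (m + 1)) :
      ∑ J, (-1 : ℝ) ^ (i : ℕ) * χ (J i) (fun j => J (i.succAbove j)) * g J =
        ∑ a, ∑ J', χ a J' * g (Fin.cons a J' : Fin (m + 1) → Fin M) := by
    rw [← (Fin.insertNthEquiv (fun _ => Fin M) i).sum_comp, Fintype.sum_prod_type]
    refine Finset.sum_congr rfl fun a _ => Finset.sum_congr rfl fun J' _ => ?_
    have hins : Fin.insertNthEquiv (fun _ => Fin M) i (a, J') =
      (Fin.cons a J' : Fin (m + 1) → Fin M) ∘ i.cycleRange := (Fin.cons_comp_cycleRange a J' i).symm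
    simp only [Fin.insertNthEquiv_apply, Fin.insertNth_apply_same, Fin.insertNth_apply_succAbove]
    rw [hins, hg.1, Fin.sign_cycleRange]
    have h2 : ((-1 : ℝ) ^ (i : ℕ)) * (-1) ^ (i : ℕ) = 1 := by
      rw [← mul_pow]
      simp
    push_cast
    linear_combination χ a J' * g (Fin.cons a J' : Fin (m + 1) → Fin M) * h2
  simp [key]

theorem altArr_wedgeF {N p q : ℕ} (ω : Form N p) (η : Form N q) (x : Pt N) :
    AltArr (wedgeF p q ω η x) := by
  refine altArr_of_perm fun I τ => ?_
  unfold wedgeF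
  rw [← Equiv.sum_comp (Equiv.mulLeft τ⁻¹), mul_left_comm, Finset.mul_sum (a := ((τ.sign : ℤ) : ℝ))]
  congr 1
  refine Finset.sum_congr rfl fun σ _ => ?_
  simp
  ring

theorem sharpF_wedgeF {N : ℕ} (Λ : Form N 2) (p q : ℕ) (φ : Form N p) (ψ : Form N q)
    (x : Pt N) (J : Fin (p + q) → Fin N) :
    sharpF Λ (p + q) (wedgeF p q φ ψ) x J =
      wedgeF p q (sharpF Λ p φ) (sharpF Λ q ψ) x J := by
  have key (σ : Equiv.Perm (Fin (p + q))) :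
      ∑ I : Fin (p + q) → Fin N, (φ x fun i => I (σ (Fin.castAdd q i))) *
          (ψ x fun j => I (σ (Fin.natAdd p j))) * ∏ t, Λ x ![I t, J t] =
        (∑ I : Fin p → Fin N, φ x I * ∏ t, Λ x ![I t, J (σ (Fin.castAdd q t))]) *
          ∑ I : Fin q → Fin N, ψ x I * ∏ t, Λ x ![I t, J (σ (Fin.natAdd p t))] := by
    rw [← (σ.arrowCongr (Equiv.refl (Fin N))).sum_comp, sum_cat rfl, Finset.sum_mul_sum]
    refine Finset.sum_congr rfl fun u _ => Finset.sum_congr rfl fun v _ => ?_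
    rw [← Equiv.prod_comp σ, Fin.prod_univ_add]
    simp [cat]
    ring
  simp only [sharpF, wedgeF]
  conv_lhs => simp only [mul_assoc, Finset.sum_mul, ← Finset.mul_sum]
  rw [mul_left_comm]
  congr 1
  rw [Finset.sum_comm]
  simp only [mul_assoc] at key
  simp only [← Finset.mul_sum, key, pow_add]
  rw [Finset.mul_sum]
  refine Finset.sum_congr rfl fun σ _ => ?_
  ring

/-- The generator of the exterior algebra given by a coordinate. -/
def extGen {N : ℕ} (i : Fin N) : ExteriorAlgebra ℝ (Fin N → ℝ) :=
  ExteriorAlgebra.ι ℝ (Pi.single i 1)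

/-- The element of the exterior algebra with a given component array. -/
def toExt {N : ℕ} (p : ℕ) (f : (Fin p → Fin N) → ℝ) : ExteriorAlgebra ℝ (Fin N → ℝ) :=
  (p.factorial : ℝ)⁻¹ •
    ∑ I, f I • ExteriorAlgebra.ιMulti ℝ p (fun t => (Pi.single (I t) 1 : Fin N → ℝ))

theorem toExt_wedgeF {N p q : ℕ} (ω : Form N p) (η : Form N q) (x : Pt N) :
    toExt (p + q) (wedgeF p q ω η x) = toExt p (ω x) * toExt q (η x) := by
  have key (σ : Equiv.Perm (Fin (p + q))) :
      ∑ I : Fin (p + q) → Fin N, (((Equiv.Perm.sign σ : ℤ) : ℝ) *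
          (ω x fun i => I (σ (Fin.castAdd q i))) * (η x fun j => I (σ (Fin.natAdd p j)))) •
          ExteriorAlgebra.ιMulti ℝ (p + q) (fun t => (Pi.single (I t) 1 : Fin N → ℝ)) =
        (∑ I : Fin p → Fin N, ω x I •
          ExteriorAlgebra.ιMulti ℝ p (fun t => (Pi.single (I t) 1 : Fin N → ℝ))) *
        ∑ I : Fin q → Fin N, η x I •
          ExteriorAlgebra.ιMulti ℝ q (fun t => (Pi.single (I t) 1 : Fin N → ℝ)) := by
    rw [← (σ.arrowCongr (Equiv.refl (Fin N))).sum_comp, ← (Fin.appendEquiv p q).sum_comp,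
      Fintype.sum_prod_type, Finset.sum_mul_sum]
    refine Finset.sum_congr rfl fun u _ => Finset.sum_congr rfl fun v _ => ?_
    have hperm := (ExteriorAlgebra.ιMulti ℝ (p + q)).map_perm
      (fun t => (Pi.single (Fin.append u v t) 1 : Fin N → ℝ)) σ⁻¹
    have happ : ExteriorAlgebra.ιMulti ℝ (p + q)
        (fun t => (Pi.single (Fin.append u v t) 1 : Fin N → ℝ)) =
        ExteriorAlgebra.ιMulti ℝ p (fun t => (Pi.single (u t) 1 : Fin N → ℝ)) *
        ExteriorAlgebra.ιMulti ℝ q (fun t => (Pi.single (v t) 1 : Fin N → ℝ)) := by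
      simp only [ExteriorAlgebra.ιMulti_apply]
      rw [← List.prod_append, ← List.ofFn_fin_append]
      congr 2
      funext t
      induction t using Fin.addCases <;> simp
    have hI : (fun t => (Pi.single ((σ.arrowCongr (Equiv.refl (Fin N)))
        (Fin.appendEquiv p q (u, v)) t) 1 : Fin N → ℝ)) =
        (fun t => (Pi.single (Fin.append u v t) 1 : Fin N → ℝ)) ∘ (σ⁻¹ : Equiv.Perm _) := rfl
    rw [hI, hperm, happ, smul_mul_smul_comm, Equiv.Perm.sign_inv, Units.smul_def,
      ← Int.cast_smul_eq_zsmul ℝ, smul_smul]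
    congr 1
    have hs := sign_mul_sign_real σ
    have h1 : (fun i => (σ.arrowCongr (Equiv.refl (Fin N))) (Fin.appendEquiv p q (u, v))
        (σ (Fin.castAdd q i))) = u := by
      funext i; simp [Fin.appendEquiv]
    have h2 : (fun i => (σ.arrowCongr (Equiv.refl (Fin N))) (Fin.appendEquiv p q (u, v))
        (σ (Fin.natAdd p i))) = v := by
      funext i; simp [Fin.appendEquiv]
    rw [h1, h2]
    linear_combination (ω x u * η x v) * hs
  simp only [toExt, wedgeF]
  simp only [mul_smul, ← Finset.smul_sum]
  simp only [Finset.sum_smul]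
  rw [Finset.sum_comm]
  simp only [key]
  simp only [Finset.sum_const, Finset.card_univ, Fintype.card_perm, Fintype.card_fin]
  rw [smul_mul_smul_comm, ← Nat.cast_smul_eq_nsmul ℝ, smul_smul, smul_smul]
  congr 1
  have := Nat.factorial_ne_zero (p + q)
  field_simp

theorem toExt_wpow {N : ℕ} (ω : Form N 2) (x : Pt N) (m : ℕ) :
    toExt (2 * m) (wpow ω m x) = toExt 2 (ω x) ^ m := by
  induction m with
  | zero =>
    show toExt 0 (fun _ => 1) = _
    simp only [toExt, pow_zero, Fintype.sum_unique]
    simp [ExteriorAlgebra.ιMulti_apply]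
  | succ m ih =>
    rw [pow_succ, ← ih]
    exact toExt_wedgeF (wpow ω m) ω x

section Lefschetz

variable {N : ℕ} (W : Matrix (Fin N) (Fin N) ℝ)

theorem toExt_two (ω : (Fin 2 → Fin N) → ℝ) :
    toExt 2 ω = (2 : ℝ)⁻¹ • ∑ a, ∑ b, ω ![a, b] • (extGen a * extGen b) := by
  unfold toExt
  rw [← (finTwoArrowEquiv (Fin N)).symm.sum_comp, Fintype.sum_prod_type]
  simp [ExteriorAlgebra.ιMulti_apply, extGen, Matrix.vecTail]

/-- The quadratic element of the exterior algebra with coefficient matrix `W`. -/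
def extQuad : ExteriorAlgebra ℝ (Fin N → ℝ) :=
  (2 : ℝ)⁻¹ • ∑ a, ∑ b, W a b • (extGen a * extGen b)

/-- The contraction of `extQuad W` with a coordinate vector. -/
def extRow (i : Fin N) : ExteriorAlgebra ℝ (Fin N → ℝ) := ∑ j, W i j • extGen j

/-- Interior product of the exterior algebra with a coordinate vector. -/
def extD (i : Fin N) : ExteriorAlgebra ℝ (Fin N → ℝ) →ₗ[ℝ] ExteriorAlgebra ℝ (Fin N → ℝ) :=
  CliffordAlgebra.contractLeft (Q := (0 : QuadraticForm ℝ (Fin N → ℝ)))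
    (LinearMap.proj i : (Fin N → ℝ) →ₗ[ℝ] ℝ)

theorem extD_gen_mul (i j : Fin N) (y : ExteriorAlgebra ℝ (Fin N → ℝ)) :
    extD i (extGen j * y) = (if i = j then (1 : ℝ) else 0) • y - extGen j * extD i y := by
  refine (CliffordAlgebra.contractLeft_ι_mul _ _ _).trans ?_
  simp only [LinearMap.proj_apply, Pi.single_apply]
  rfl

theorem extD_one (i : Fin N) : extD i 1 = 0 :=
  CliffordAlgebra.contractLeft_one _ _

theorem extGen_mul_swap (i j : Fin N) : extGen i * extGen j = -(extGen j * extGen i) :=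
  eq_neg_of_add_eq_zero_left (ExteriorAlgebra.ι_add_mul_swap _ _)

theorem commute_extGen_extQuad (j : Fin N) : Commute (extGen j) (extQuad W) := by
  refine Commute.smul_right (Commute.sum_right _ _ _ fun a _ => Commute.sum_right _ _ _ fun b _ =>
    Commute.smul_right ?_ _) _
  show extGen j * (extGen a * extGen b) = extGen a * extGen b * extGen j
  rw [← mul_assoc, extGen_mul_swap j a, mul_assoc, neg_mul, mul_assoc, extGen_mul_swap j b,
    mul_neg, neg_neg]

theorem commute_extRow_extQuad (i : Fin N) : Commute (extRow W i) (extQuad W) :=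
  Commute.sum_left _ _ _ fun j _ => (commute_extGen_extQuad W j).smul_left _

variable {W}

theorem extD_extQuad_mul (hW : ∀ i j, W j i = -W i j) (i : Fin N)
    (y : ExteriorAlgebra ℝ (Fin N → ℝ)) :
    extD i (extQuad W * y) = extRow W i * y + extQuad W * extD i y := by
  have h : ∀ a b, extD i (extGen a * (extGen b * y)) =
      (if i = a then (1 : ℝ) else 0) • (extGen b * y) -
        (if i = b then (1 : ℝ) else 0) • (extGen a * y) + extGen a * (extGen b * extD i y) := by
    intro a b
    rw [extD_gen_mul, extD_gen_mul, mul_sub, mul_smul_comm]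
    abel
  simp only [extQuad, extRow, smul_mul_assoc, Finset.sum_mul, map_smul, map_sum, mul_assoc, h,
    smul_add, smul_sub, Finset.sum_add_distrib, Finset.sum_sub_distrib, smul_smul]
  congr 1
  simp only [mul_ite, mul_one, mul_zero, ite_smul, zero_smul, Finset.sum_ite_eq,
    Finset.mem_univ, if_true]
  rw [Finset.sum_comm]
  simp only [Finset.sum_ite_eq, Finset.mem_univ, if_true]
  simp only [hW i, neg_smul, Finset.sum_neg_distrib, smul_neg, sub_neg_eq_add]
  rw [← add_smul]
  norm_num

theorem extD_extQuad_pow (hW : ∀ i j, W j i = -W i j) (i : Fin N) (k : ℕ) :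
    extD i (extQuad W ^ (k + 1)) = ((k + 1 : ℕ) : ℝ) • (extRow W i * extQuad W ^ k) := by
  induction k with
  | zero =>
    have := extD_extQuad_mul hW i 1
    simpa [extD_one] using this
  | succ k ih =>
    rw [pow_succ', extD_extQuad_mul hW, ih, mul_smul_comm, ← mul_assoc,
      ← (commute_extRow_extQuad W i).eq, mul_assoc, ← pow_succ', Nat.cast_succ (k + 1), add_smul,
      one_smul, add_comm]

theorem sum_extGen_mul_extD (hW : ∀ i j, W j i = -W i j) (k : ℕ) :
    ∑ i, extGen i * extD i (extQuad W ^ k) = (2 * k : ℝ) • extQuad W ^ k := by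
  cases k with
  | zero => simp [extD_one]
  | succ k =>
    have h : ∑ i, extGen i * extRow W i = (2 : ℝ) • extQuad W := by
      simp [extQuad, extRow, smul_smul, Finset.mul_sum]
    simp only [extD_extQuad_pow hW, mul_smul_comm, ← mul_assoc, ← Finset.smul_sum,
      ← Finset.sum_mul, h]
    rw [smul_mul_assoc, ← pow_succ', smul_smul, mul_comm]

theorem extQuad_pow_ne_zero {L : Matrix (Fin N) (Fin N) ℝ} (hW : ∀ i j, W j i = -W i j)
    (hL : L * W = -1) (k : ℕ) (hk : 2 * k ≤ N) : extQuad W ^ k ≠ 0 := by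
  induction k with
  | zero => simp
  | succ k ih =>
    intro h0
    apply ih (by omega)
    have hrow (i : Fin N) : extRow W i * extQuad W ^ k = 0 := by
      have := extD_extQuad_pow hW i k
      rw [h0, map_zero] at this
      exact (smul_eq_zero.1 this.symm).resolve_left (by positivity)
    have hgen (j : Fin N) : extGen j * extQuad W ^ k = 0 := by
      have hj : extGen j = -∑ i, L j i • extRow W i := by
        simp only [extRow, Finset.smul_sum, smul_smul]
        rw [Finset.sum_comm]
        simp only [← Finset.sum_smul, ← Matrix.mul_apply, hL]
        simp [Matrix.one_apply]
      rw [hj, neg_mul, Finset.sum_mul]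
      simp [hrow]
    have hsum : ∑ i : Fin N, extD i (extGen i * extQuad W ^ k) = 0 := by simp [hgen]
    simp only [extD_gen_mul, if_true, one_smul, Finset.sum_sub_distrib,
      sum_extGen_mul_extD hW] at hsum
    simp only [Finset.sum_const, Finset.card_univ, Fintype.card_fin] at hsum
    rw [← Nat.cast_smul_eq_nsmul ℝ, ← sub_smul] at hsum
    refine (smul_eq_zero.1 hsum).resolve_left ?_
    have : (2 * (k + 1 : ℕ) : ℝ) ≤ N := by exact_mod_cast hk
    push_cast at this
    linarith

end Lefschetz

theorem AltArr.swap_two {N : ℕ} {f : (Fin 2 → Fin N) → ℝ} (hf : AltArr f) (i j : Fin N) :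
    f ![j, i] = -f ![i, j] := by
  have h : (![j, i] : Fin 2 → Fin N) = ![i, j] ∘ Equiv.swap 0 1 := by
    funext t
    fin_cases t <;> simp
  rw [h, hf.1, Equiv.Perm.sign_swap (by decide)]
  simp

theorem altArr_wpow {N : ℕ} (ω : Form N 2) (m : ℕ) (x : Pt N) : AltArr (wpow ω m x) := by
  cases m with
  | zero =>
    refine altArr_of_perm fun I σ => ?_
    have : IsEmpty (Fin (2 * 0)) := Fin.isEmpty
    simp [wpow, Subsingleton.elim σ 1]
  | succ m => exact altArr_wedgeF (wpow ω m) ω x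

theorem altArr_volF {N : ℕ} (n : ℕ) (ω : Form N 2) (x : Pt N) : AltArr (volF n ω x) :=
  (altArr_wpow ω n x).const_mul _

/-- Nondegeneracy makes the Liouville volume nonzero. -/
theorem volF_ne_zero {n : ℕ} {ω : Form (2 * n) 2} {x : Pt (2 * n)}
    {L : Matrix (Fin (2 * n)) (Fin (2 * n)) ℝ} (hω : AltArr (ω x)) (hL : mat2 ω x * L = -1) :
    volF n ω x id ≠ 0 := by
  intro h0
  have hL' : L * mat2 ω x = -1 := by
    have h1 : (-mat2 ω x) * L = 1 := by rw [neg_mul, hL, neg_neg]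
    rw [mul_eq_one_comm, mul_neg] at h1
    rw [← h1, neg_neg]
  have hz : wpow ω n x = 0 := by
    funext I
    have h1 : wpow ω n x id = 0 :=
      (mul_eq_zero.1 h0).resolve_left (inv_ne_zero (by exact_mod_cast n.factorial_ne_zero))
    rw [(altArr_wpow ω n x).eq_leviCivita I, h1, zero_mul, Pi.zero_apply]
  refine extQuad_pow_ne_zero (W := mat2 ω x) (fun i j => hω.swap_two i j) hL' n le_rfl ?_
  have hq : extQuad (mat2 ω x) = toExt 2 (ω x) := (toExt_two (ω x)).symm
  rw [hq, ← toExt_wpow, hz]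
  simp [toExt]

theorem adjF_apply {n : ℕ} (ω₀ Λ₀ : Form (2 * n) 2) {p : ℕ} (h : p + (2 * n - p) = 2 * n)
    (φ : Form (2 * n) p) (x : Pt (2 * n)) (J : Fin (2 * n - p) → Fin (2 * n)) :
    adjF ω₀ Λ₀ p φ x J = volF n ω₀ x id * (p.factorial : ℝ)⁻¹ *
      ∑ I, sharpF Λ₀ p φ x I * leviCivita (cat h I J) := by
  have hsign : ((-1 : ℝ) ^ (p * (p - 1) / 2)) * (-1) ^ (p * (p - 1) / 2) = 1 := by
    rw [← mul_pow]
    simp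
  have hsum : ∑ I, sharpF Λ₀ p φ x I * volF n ω₀ x (catIdx I J) =
      volF n ω₀ x id * ∑ I, sharpF Λ₀ p φ x I * leviCivita (cat h I J) := by
    rw [Finset.mul_sum]
    refine Finset.sum_congr rfl fun I _ => ?_
    rw [(altArr_volF n ω₀ x).eq_leviCivita, catIdx_eq_cat h]
    ring
  simp only [adjF, smulF, iF, hsum]
  linear_combination (p.factorial : ℝ)⁻¹ * volF n ω₀ x id *
    (∑ I, sharpF Λ₀ p φ x I * leviCivita (cat h I J)) * hsign

theorem sharpF_adjF {n : ℕ} (ω₀ : Form (2 * n) 2) {Λ₀ : Form (2 * n) 2} {q : ℕ}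
    (h : q + (2 * n - q) = 2 * n) (ψ : Form (2 * n) q) {x : Pt (2 * n)} (hΛ : AltArr (Λ₀ x))
    (K : Fin (2 * n - q) → Fin (2 * n)) :
    sharpF Λ₀ (2 * n - q) (adjF ω₀ Λ₀ q ψ) x K =
      (-1) ^ (2 * n - q) * volF n ω₀ x id * (mat2 Λ₀ x).det * (q.factorial : ℝ)⁻¹ *
        ∑ J, ψ x J * leviCivita (cat h J K) := by
  have hadj : adjF ω₀ Λ₀ q ψ x = fun K' => (volF n ω₀ x id * (q.factorial : ℝ)⁻¹ * (-1) ^ q) *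
      ∑ J, pullArr (mat2 Λ₀ x) (ψ x) J * leviCivita (cat h J K') := by
    funext K'
    rw [adjF_apply ω₀ Λ₀ h]
    simp only [sharpF_eq_pullArr, mul_assoc, ← Finset.mul_sum]
  have hmul (c : ℝ) (g : (Fin (2 * n - q) → Fin (2 * n)) → ℝ) :
      pullArr (mat2 Λ₀ x) (fun K' => c * g K') K = c * pullArr (mat2 Λ₀ x) g K := by
    simp only [pullArr, Finset.mul_sum, mul_assoc]
  rw [sharpF_eq_pullArr, hadj, hmul,
    pullArr_sum_leviCivita (L := mat2 Λ₀ x) h fun i j => hΛ.swap_two i j]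
  have hsign : ((-1 : ℝ) ^ q) * (-1) ^ q = 1 := by
    rw [← mul_pow]
    simp
  linear_combination (-1) ^ (2 * n - q) * volF n ω₀ x id * (mat2 Λ₀ x).det *
    (q.factorial : ℝ)⁻¹ * (∑ J, ψ x J * leviCivita (cat h J K)) * hsign

theorem sharpF_castF {N s r : ℕ} (Λ : Form N 2) (h : s = r) (ψ : Form N s) (x : Pt N)
    (K : Fin r → Fin N) : sharpF Λ r (castF h ψ) x K = sharpF Λ s ψ x (K ∘ Fin.cast h) := by
  subst h
  rfl

theorem cat_comp_cast {X : Type*} {q s r N : ℕ} (e : s = r) (h : q + s = N) (h' : q + r = N)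
    (u : Fin q → X) (v : Fin r → X) : cat h u (v ∘ Fin.cast e) = cat h' u v := by
  subst e
  rfl

section Smooth

variable {N : ℕ} {M : Set (Pt N)}

theorem contDiffOn_wedgeF {p q : ℕ} {ω : Form N p} {η : Form N q}
    (hω : ∀ I, ContDiffOn ℝ (⊤ : ℕ∞) (fun x => ω x I) M)
    (hη : ∀ I, ContDiffOn ℝ (⊤ : ℕ∞) (fun x => η x I) M) (I : Fin (p + q) → Fin N) :
    ContDiffOn ℝ (⊤ : ℕ∞) (fun x => wedgeF p q ω η x I) M :=
  contDiffOn_const.mul <| ContDiffOn.sum fun _ _ => (contDiffOn_const.mul (hω _)).mul (hη _)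

theorem contDiffOn_wpow {ω : Form N 2} (hω : ∀ I, ContDiffOn ℝ (⊤ : ℕ∞) (fun x => ω x I) M)
    (m : ℕ) : ∀ I, ContDiffOn ℝ (⊤ : ℕ∞) (fun x => wpow ω m x I) M := by
  induction m with
  | zero => exact fun _ => contDiffOn_const
  | succ m ih => exact fun I => contDiffOn_wedgeF ih hω I

theorem contDiffOn_sharpF {Λ : Form N 2} {p : ℕ} {ζ : Form N p}
    (hΛ : ∀ I, ContDiffOn ℝ (⊤ : ℕ∞) (fun x => Λ x I) M)
    (hζ : ∀ I, ContDiffOn ℝ (⊤ : ℕ∞) (fun x => ζ x I) M) (J : Fin p → Fin N) :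
    ContDiffOn ℝ (⊤ : ℕ∞) (fun x => sharpF Λ p ζ x J) M :=
  contDiffOn_const.mul <| ContDiffOn.sum fun _ _ =>
    (hζ _).mul (contDiffOn_prod fun _ _ => hΛ _)

theorem IsFormOn.sharpF {Λ : Form N 2} {p : ℕ} {ζ : Form N p} (hΛ : IsFormOn Λ M)
    (hζ : IsFormOn ζ M) : IsFormOn (sharpF Λ p ζ) M :=
  ⟨fun x hx => ((hζ.1 x hx).pullArr (mat2 Λ x)).const_mul _, contDiffOn_sharpF hΛ.2 hζ.2⟩

theorem IsFormOn.wedgeF {p q : ℕ} {ω : Form N p} {η : Form N q} (hω : IsFormOn ω M)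
    (hη : IsFormOn η M) : IsFormOn (wedgeF p q ω η) M :=
  ⟨fun x _ => altArr_wedgeF ω η x, contDiffOn_wedgeF hω.2 hη.2⟩

theorem differentiableAt_of_contDiffOn {f : Pt N → ℝ} (hM : IsOpen M)
    (hf : ContDiffOn ℝ (⊤ : ℕ∞) f M) {x : Pt N} (hx : x ∈ M) : DifferentiableAt ℝ f x :=
  (hf.differentiableOn (by simp)).differentiableAt (hM.mem_nhds hx)

end Smooth

/-- In multivector terms the codifferential is the divergence with respect to the volume form,
up to a factor independent of the degree. -/
theorem sharpF_codiffF {n : ℕ} {M : Set (Pt (2 * n))} (hM : IsOpen M)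
    {ω₀ Λ₀ : Form (2 * n) 2} (hω : IsFormOn ω₀ M) (hΛ : IsFormOn Λ₀ M) {r : ℕ} (hr : Odd r)
    {φ : Form (2 * n) (r + 1)} (hφ : IsFormOn φ M) {x : Pt (2 * n)} (hx : x ∈ M)
    (K : Fin r → Fin (2 * n)) :
    sharpF Λ₀ r (codiffF ω₀ Λ₀ (r + 1) φ) x K = volF n ω₀ x id * (mat2 Λ₀ x).det *
      ∑ a, pd (fun y => volF n ω₀ y id *
        sharpF Λ₀ (r + 1) φ y (Fin.snoc K a : Fin (r + 1) → Fin (2 * n))) a x := by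
  set Q : Fin (2 * n) → (Fin (r + 1) → Fin (2 * n)) → ℝ := fun a I =>
    pd (fun y => volF n ω₀ y id * sharpF Λ₀ (r + 1) φ y I) a x with hQ
  have hP : IsFormOn (sharpF Λ₀ (r + 1) φ) M := hΛ.sharpF hφ
  have hf : ContDiffOn ℝ (⊤ : ℕ∞) (fun y => volF n ω₀ y id) M :=
    contDiffOn_const.mul (contDiffOn_wpow hω.2 n _)
  have hd (I : Fin (r + 1) → Fin (2 * n)) :
      DifferentiableAt ℝ (fun y => volF n ω₀ y id * sharpF Λ₀ (r + 1) φ y I) x :=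
    differentiableAt_of_contDiffOn hM (hf.mul (hP.2 I)) hx
  have hQalt (a : Fin (2 * n)) : AltArr (Q a) := by
    refine altArr_of_perm fun I σ => ?_
    simp only [hQ, pd]
    have he : (fun y => volF n ω₀ y id * sharpF Λ₀ (r + 1) φ y (I ∘ σ)) =ᶠ[nhds x]
        fun y => ((Equiv.Perm.sign σ : ℤ) : ℝ) *
          (volF n ω₀ y id * sharpF Λ₀ (r + 1) φ y I) := by
      filter_upwards [hM.mem_nhds hx] with y hy
      rw [(hP.1 y hy).1]
      ring
    rw [he.fderiv_eq, fderiv_const_mul (hd I)]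
    rfl
  by_cases hle : r + 1 ≤ 2 * n
  swap
  · have hcast : codiffF ω₀ Λ₀ (r + 1) φ = fun _ _ => 0 := by
      unfold codiffF castT
      rw [dif_neg]
      obtain ⟨k, rfl⟩ := hr
      omega
    rw [hcast, Finset.sum_eq_zero, mul_zero]
    · simp [sharpF]
    · intro a _
      refine (hQalt a).2 _ fun hinj => hle ?_
      simpa using Fintype.card_le_of_injective _ hinj
  have h₁ : r + 1 + (2 * n - (r + 1)) = 2 * n := by omega
  have h₂ : 2 * n - (r + 1) + 1 + (2 * n - (2 * n - (r + 1) + 1)) = 2 * n := by omega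
  have e : 2 * n - (2 * n - (r + 1) + 1) = r := by omega
  have h₃ : 2 * n - (r + 1) + 1 + r = 2 * n := by omega
  have hm : Even (2 * n - (r + 1)) := by
    obtain ⟨k, rfl⟩ := hr
    exact ⟨n - k - 1, by omega⟩
  have hcod : codiffF ω₀ Λ₀ (r + 1) φ =
      castF e (adjF ω₀ Λ₀ (2 * n - (r + 1) + 1) (extd (adjF ω₀ Λ₀ (r + 1) φ))) := by
    unfold codiffF castT
    exact dif_pos e
  have hfd (a : Fin (2 * n)) (J : Fin (2 * n - (r + 1)) → Fin (2 * n)) :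
      fderiv ℝ (fun y => adjF ω₀ Λ₀ (r + 1) φ y J) x (Pi.single a 1) =
        ((r + 1).factorial : ℝ)⁻¹ * ∑ I, Q a I * leviCivita (cat h₁ I J) := by
    have hfun : (fun y => adjF ω₀ Λ₀ (r + 1) φ y J) = fun y => ∑ I,
        (((r + 1).factorial : ℝ)⁻¹ * leviCivita (cat h₁ I J)) *
          (volF n ω₀ y id * sharpF Λ₀ (r + 1) φ y I) := by
      funext y
      rw [adjF_apply ω₀ Λ₀ h₁, Finset.mul_sum]
      exact Finset.sum_congr rfl fun I _ => by ring
    rw [hfun, fderiv_fun_sum fun I _ => (hd I).const_mul _, sum_apply,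
      Finset.mul_sum]
    refine Finset.sum_congr rfl fun I _ => ?_
    rw [fderiv_const_mul (hd I)]
    simp only [hQ, pd, smul_apply, smul_eq_mul]
    ring
  obtain ⟨χ, hχ⟩ : ∃ χ : Fin (2 * n) → (Fin (2 * n - (r + 1)) → Fin (2 * n)) → ℝ,
      ∀ a J, χ a J = ((r + 1).factorial : ℝ)⁻¹ * ∑ I, Q a I * leviCivita (cat h₁ I J) :=
    ⟨_, fun _ _ => rfl⟩
  have hext (J : Fin (2 * n - (r + 1) + 1) → Fin (2 * n)) :
      extd (adjF ω₀ Λ₀ (r + 1) φ) x J = ∑ i : Fin (2 * n - (r + 1) + 1), (-1 : ℝ) ^ (i : ℕ) *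
        χ (J i) (fun j => J (i.succAbove j)) :=
    Finset.sum_congr rfl fun i _ => by rw [hfd, hχ]
  rw [hcod, sharpF_castF, sharpF_adjF ω₀ h₂ _ (hΛ.1 x hx)]
  simp only [cat_comp_cast e h₂ h₃, hext]
  rw [(altArr_leviCivita.cat_left h₃ K).sum_antisymmetrize χ]
  have hinner (a : Fin (2 * n)) :
      ∑ J', χ a J' *
        leviCivita (cat h₃ (Fin.cons a J' : Fin (2 * n - (r + 1) + 1) → Fin (2 * n)) K) =
      -((2 * n - (r + 1)).factorial * Q a (Fin.snoc K a : Fin (r + 1) → Fin (2 * n))) := by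
    have hc := (hQalt a).sum_leviCivita_mul_leviCivita h₁
      (Fin.snoc K a : Fin (r + 1) → Fin (2 * n))
    simp only [hχ, altArr_leviCivita.cat_cons_eq_neg_cat_snoc h₃ h₁ hm hr, mul_neg,
      Finset.sum_neg_distrib, mul_assoc, ← Finset.mul_sum, Finset.sum_mul, hc]
    have := Nat.factorial_ne_zero (r + 1)
    field_simp
  simp only [hinner, Finset.sum_neg_distrib, ← Finset.mul_sum]
  rw [e, hr.neg_one_pow, Nat.factorial_succ]
  have h0 : ((2 * n - (r + 1)).factorial : ℝ) ≠ 0 := by exact_mod_cast Nat.factorial_ne_zero _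
  have h0' : ((2 * n - (r + 1) : ℕ) : ℝ) + 1 ≠ 0 := by positivity
  push_cast [-Nat.cast_sub]
  field_simp
  rfl

theorem sum_perm_sign_mul_succ {n : ℕ} (F : (Fin (n + 1) → Fin (n + 1)) → ℝ) :
    ∑ σ : Equiv.Perm (Fin (n + 1)), ((Equiv.Perm.sign σ : ℤ) : ℝ) * F σ =
      ∑ p : Fin (n + 1), (if p = 0 then 1 else -1) * ∑ e : Equiv.Perm (Fin n),
        ((Equiv.Perm.sign e : ℤ) : ℝ) *
          F (Matrix.vecCons p fun i => Equiv.swap 0 p (e i).succ) := by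
  rw [← Equiv.sum_comp Equiv.Perm.decomposeFin.symm, Fintype.sum_prod_type]
  refine Finset.sum_congr rfl fun p _ => ?_
  rw [Finset.mul_sum]
  refine Finset.sum_congr rfl fun e _ => ?_
  have : ⇑(Equiv.Perm.decomposeFin.symm (p, e)) =
      Matrix.vecCons p fun i => Equiv.swap 0 p (e i).succ := by
    funext i
    refine Fin.cases ?_ (fun i => ?_) i <;> simp
  rw [this, Equiv.Perm.decomposeFin.symm_sign]
  split_ifs <;> simp

theorem sum_perm_fin_three (F : Fin 3 → Fin 3 → Fin 3 → ℝ) :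
    ∑ σ : Equiv.Perm (Fin 3), ((Equiv.Perm.sign σ : ℤ) : ℝ) * F (σ 0) (σ 1) (σ 2) =
      F 0 1 2 - F 0 2 1 + F 1 2 0 - F 1 0 2 + F 2 0 1 - F 2 1 0 := by
  rw [sum_perm_sign_mul_succ fun v => F (v 0) (v 1) (v 2)]
  have h (p : Fin 3) := sum_perm_sign_mul_succ fun v : Fin 2 → Fin 2 =>
    F p (Equiv.swap 0 p (v 0).succ) (Equiv.swap 0 p (v 1).succ)
  simp only [Matrix.cons_val, h]
  simp [Fin.sum_univ_succ, Equiv.swap_apply_def]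
  ring

theorem sum_perm_fin_four (F : Fin 4 → Fin 4 → Fin 4 → Fin 4 → ℝ) :
    ∑ σ : Equiv.Perm (Fin 4), ((Equiv.Perm.sign σ : ℤ) : ℝ) * F (σ 0) (σ 1) (σ 2) (σ 3) =
      F 0 1 2 3 - F 0 1 3 2 + F 0 2 3 1 - F 0 2 1 3 + F 0 3 1 2 - F 0 3 2 1 -
      (F 1 0 2 3 - F 1 0 3 2 + F 1 2 3 0 - F 1 2 0 3 + F 1 3 0 2 - F 1 3 2 0) -
      (F 2 1 0 3 - F 2 1 3 0 + F 2 0 3 1 - F 2 0 1 3 + F 2 3 1 0 - F 2 3 0 1) -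
      (F 3 1 2 0 - F 3 1 0 2 + F 3 2 0 1 - F 3 2 1 0 + F 3 0 1 2 - F 3 0 2 1) := by
  rw [sum_perm_sign_mul_succ fun v => F (v 0) (v 1) (v 2) (v 3)]
  have h (p : Fin 4) := sum_perm_fin_three fun a b c =>
    F p (Equiv.swap 0 p a.succ) (Equiv.swap 0 p b.succ) (Equiv.swap 0 p c.succ)
  simp only [Matrix.cons_val, h]
  simp [Fin.sum_univ_succ, Equiv.swap_apply_def]
  ring

theorem apply_pair {X : Type*} {N : ℕ} (f : (Fin 2 → Fin N) → X) (u : Fin 2 → Fin N) :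
    f u = f ![u 0, u 1] :=
  congrArg f (by ext t; fin_cases t <;> rfl)

theorem wedgeF_two_one {N : ℕ} {A : Form N 2} {x : Pt N} (hA : AltArr (A x)) (β : Form N 1)
    (i j k : Fin N) :
    wedgeF 2 1 A β x ![i, j, k] =
      A x ![i, j] * β x ![k] - A x ![i, k] * β x ![j] + A x ![j, k] * β x ![i] := by
  have hβ (u : Fin 1 → Fin N) : β x u = β x ![u 0] :=
    congrArg (β x) (by ext t; fin_cases t; rfl)
  have hw : wedgeF 2 1 A β x ![i, j, k] = 2⁻¹ * ∑ σ : Equiv.Perm (Fin 3),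
      ((Equiv.Perm.sign σ : ℤ) : ℝ) * (A x ![![i, j, k] (σ 0), ![i, j, k] (σ 1)] *
        β x ![![i, j, k] (σ 2)]) := by
    unfold wedgeF
    congr 1
    · norm_num
    · refine Finset.sum_congr rfl fun σ _ => ?_
      rw [apply_pair (A x) fun _ => _, hβ fun _ => _, mul_assoc]
      rfl
  rw [hw, sum_perm_fin_three fun a b c => A x ![![i, j, k] a, ![i, j, k] b] * β x ![![i, j, k] c]]
  simp only [Matrix.cons_val]
  rw [hA.swap_two i j, hA.swap_two i k, hA.swap_two j k]
  ring

theorem wedgeF_two_two {N : ℕ} {A : Form N 2} {x : Pt N} (hA : AltArr (A x))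
    (i j k l : Fin N) :
    wedgeF 2 2 A A x ![i, j, k, l] =
      2 * (A x ![i, j] * A x ![k, l] - A x ![i, k] * A x ![j, l] + A x ![i, l] * A x ![j, k]) := by
  have hw : wedgeF 2 2 A A x ![i, j, k, l] = 4⁻¹ * ∑ σ : Equiv.Perm (Fin 4),
      ((Equiv.Perm.sign σ : ℤ) : ℝ) * (A x ![![i, j, k, l] (σ 0), ![i, j, k, l] (σ 1)] *
        A x ![![i, j, k, l] (σ 2), ![i, j, k, l] (σ 3)]) := by
    unfold wedgeF
    congr 1
    · norm_num
    · refine Finset.sum_congr rfl fun σ _ => ?_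
      rw [apply_pair (A x) fun t => ![i, j, k, l] (σ (Fin.castAdd 2 t)),
        apply_pair (A x) fun t => ![i, j, k, l] (σ (Fin.natAdd 2 t)), mul_assoc]
      rfl
  rw [hw, sum_perm_fin_four fun a b c d =>
    A x ![![i, j, k, l] a, ![i, j, k, l] b] * A x ![![i, j, k, l] c, ![i, j, k, l] d]]
  simp only [Matrix.cons_val]
  rw [hA.swap_two i j, hA.swap_two i k, hA.swap_two j k, hA.swap_two i l, hA.swap_two j l,
    hA.swap_two k l]
  ring

theorem pd_pd_comm {N : ℕ} {M : Set (Pt N)} (hM : IsOpen M) {g : Pt N → ℝ}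
    (hg : ContDiffOn ℝ (⊤ : ℕ∞) g M) {x : Pt N} (hx : x ∈ M) (i j : Fin N) :
    pd (fun y => pd g i y) j x = pd (fun y => pd g j y) i x := by
  have hat : ContDiffAt ℝ (⊤ : ℕ∞) g x := hg.contDiffAt (hM.mem_nhds hx)
  have hd : DifferentiableAt ℝ (fderiv ℝ g) x :=
    (hat.fderiv_right (m := 1) (by norm_cast)).differentiableAt (by simp)
  have hsymm : IsSymmSndFDerivAt ℝ g x :=
    hat.isSymmSndFDerivAt (by simp [minSmoothness_of_isRCLikeNormedField]; norm_cast)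
  have key (a b : Fin N) : pd (fun y => pd g a y) b x =
      fderiv ℝ (fderiv ℝ g) x (Pi.single b 1) (Pi.single a 1) := by
    simp [pd, fderiv_clm_apply hd (differentiableAt_const _)]
  rw [key, key, hsymm.eq]

theorem contDiffOn_pd {N : ℕ} {M : Set (Pt N)} (hM : IsOpen M) {g : Pt N → ℝ}
    (hg : ContDiffOn ℝ (⊤ : ℕ∞) g M) (i : Fin N) :
    ContDiffOn ℝ (⊤ : ℕ∞) (fun y => pd g i y) M :=
  (hg.fderiv_of_isOpen hM (by norm_cast)).clm_apply contDiffOn_const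

/-- Half of the coordinate expression of the Schouten bracket `[Λ, Λ]`. -/
def schouten {N : ℕ} (Λ : Form N 2) (x : Pt N) (i j k : Fin N) : ℝ :=
  ∑ a, (Λ x ![i, a] * pd (fun y => Λ y ![j, k]) a x + Λ x ![j, a] * pd (fun y => Λ y ![k, i]) a x +
    Λ x ![k, a] * pd (fun y => Λ y ![i, j]) a x)

section Jacobi

variable {N : ℕ} {M : Set (Pt N)} {Λ : Form N 2} {x : Pt N}

theorem sum_rotate {ι κ μ : Type*} [Fintype ι] [Fintype κ] [Fintype μ] (F : ι → κ → μ → ℝ) :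
    ∑ i, ∑ j, ∑ l, F i j l = ∑ j, ∑ l, ∑ i, F i j l := by
  rw [Finset.sum_comm]
  exact Finset.sum_congr rfl fun _ _ => Finset.sum_comm

theorem pd_braF (hM : IsOpen M) (hΛ : IsFormOn Λ M) {g h : Pt N → ℝ}
    (hg : ContDiffOn ℝ (⊤ : ℕ∞) g M) (hh : ContDiffOn ℝ (⊤ : ℕ∞) h M) (hx : x ∈ M) (a : Fin N) :
    pd (braF Λ g h) a x = ∑ i, ∑ j, (pd (fun y => Λ y ![i, j]) a x * pd g i x * pd h j x +
      Λ x ![i, j] * pd (fun y => pd g i y) a x * pd h j x +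
      Λ x ![i, j] * pd g i x * pd (fun y => pd h j y) a x) := by
  have dΛ (i j) : DifferentiableAt ℝ (fun y => Λ y ![i, j]) x :=
    differentiableAt_of_contDiffOn hM (hΛ.2 _) hx
  have dg (i) : DifferentiableAt ℝ (fun y => pd g i y) x :=
    differentiableAt_of_contDiffOn hM (contDiffOn_pd hM hg i) hx
  have dh (i) : DifferentiableAt ℝ (fun y => pd h i y) x :=
    differentiableAt_of_contDiffOn hM (contDiffOn_pd hM hh i) hx
  rw [pd, show braF Λ g h = fun y => ∑ i, ∑ j, Λ y ![i, j] * pd g i y * pd h j y from rfl,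
    fderiv_fun_sum fun i _ => DifferentiableAt.fun_sum fun j _ => ((dΛ i j).fun_mul (dg i)).fun_mul (dh j),
    sum_apply]
  refine Finset.sum_congr rfl fun i _ => ?_
  rw [fderiv_fun_sum fun j _ => ((dΛ i j).fun_mul (dg i)).fun_mul (dh j), sum_apply]
  refine Finset.sum_congr rfl fun j _ => ?_
  rw [fderiv_fun_mul ((dΛ i j).fun_mul (dg i)) (dh j), fderiv_fun_mul (dΛ i j) (dg i)]
  simp only [add_apply, smul_apply, smul_eq_mul, pd]
  ring

/-- One term of the Jacobi identity: the second derivatives occur only through their symmetric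
pairings with hamiltonian vector fields. -/
theorem braF_braF (hM : IsOpen M) (hΛ : IsFormOn Λ M) {g h k : Pt N → ℝ}
    (hh : ContDiffOn ℝ (⊤ : ℕ∞) h M) (hk : ContDiffOn ℝ (⊤ : ℕ∞) k M) (hx : x ∈ M) :
    braF Λ g (braF Λ h k) x =
      ∑ i, ∑ j, ∑ l, pd g i x * pd h j x * pd k l x *
        ∑ a, Λ x ![i, a] * pd (fun y => Λ y ![j, l]) a x
      - ∑ a, ∑ b, pd (fun y => pd h a y) b x * hamV Λ g x b * hamV Λ k x a
      + ∑ a, ∑ b, pd (fun y => pd k a y) b x * hamV Λ g x b * hamV Λ h x a := by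
  have key (b : Fin N) : pd (braF Λ h k) b x =
      ∑ i, ∑ j, pd (fun y => Λ y ![i, j]) b x * pd h i x * pd k j x
      - ∑ a, pd (fun y => pd h a y) b x * hamV Λ k x a
      + ∑ a, pd (fun y => pd k a y) b x * hamV Λ h x a := by
    rw [pd_braF hM hΛ hh hk hx]
    simp only [Finset.sum_add_distrib, hamV, sharpV, grad, Finset.mul_sum]
    rw [sub_eq_add_neg, ← Finset.sum_neg_distrib]
    congr 1
    · congr 1
      refine Finset.sum_congr rfl fun a _ => ?_
      rw [← Finset.sum_neg_distrib]
      refine Finset.sum_congr rfl fun c _ => ?_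
      rw [(hΛ.1 x hx).swap_two a c]
      ring
    · rw [Finset.sum_comm]
      exact Finset.sum_congr rfl fun a _ => Finset.sum_congr rfl fun c _ => by ring
  have hbra : braF Λ g (braF Λ h k) x = ∑ b, hamV Λ g x b * pd (braF Λ h k) b x := by
    simp only [braF, hamV, sharpV, grad, Finset.sum_mul]
    exact Finset.sum_comm
  rw [hbra]
  simp only [key, mul_add, mul_sub, Finset.sum_add_distrib, Finset.sum_sub_distrib, Finset.mul_sum]
  congr 1
  · congr 1
    · simp only [hamV, sharpV, grad, Finset.sum_mul]
      conv_rhs =>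
        enter [2, i]
        rw [sum_rotate, sum_rotate]
      conv_rhs =>
        rw [Finset.sum_comm]
        enter [2, a]
        rw [sum_rotate]
      refine Finset.sum_congr rfl fun b _ => ?_
      exact Finset.sum_congr rfl fun j _ => Finset.sum_congr rfl fun l _ =>
        Finset.sum_congr rfl fun i _ => by ring
    · rw [Finset.sum_comm]
      exact Finset.sum_congr rfl fun a _ => Finset.sum_congr rfl fun c _ => by ring
  · rw [Finset.sum_comm]
    exact Finset.sum_congr rfl fun a _ => Finset.sum_congr rfl fun c _ => by ring

theorem jacobiator_eq (hM : IsOpen M) (hΛ : IsFormOn Λ M) {g h k : Pt N → ℝ}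
    (hg : ContDiffOn ℝ (⊤ : ℕ∞) g M) (hh : ContDiffOn ℝ (⊤ : ℕ∞) h M)
    (hk : ContDiffOn ℝ (⊤ : ℕ∞) k M) (hx : x ∈ M) :
    braF Λ g (braF Λ h k) x + braF Λ h (braF Λ k g) x + braF Λ k (braF Λ g h) x =
      ∑ i, ∑ j, ∑ l, pd g i x * pd h j x * pd k l x * schouten Λ x i j l := by
  have hsymm {f : Pt N → ℝ} (hf : ContDiffOn ℝ (⊤ : ℕ∞) f M) (u v : Fin N → ℝ) :
      ∑ a, ∑ b, pd (fun y => pd f a y) b x * u b * v a =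
        ∑ a, ∑ b, pd (fun y => pd f a y) b x * v b * u a := by
    rw [Finset.sum_comm]
    refine Finset.sum_congr rfl fun a _ => Finset.sum_congr rfl fun b _ => ?_
    rw [pd_pd_comm hM hf hx]
    ring
  rw [braF_braF hM hΛ hh hk hx, braF_braF hM hΛ hk hg hx, braF_braF hM hΛ hg hh hx,
    hsymm hg (hamV Λ h x), hsymm hh (hamV Λ g x), hsymm hk (hamV Λ g x)]
  simp only [schouten, Finset.sum_add_distrib, mul_add]
  set X : Fin N → Fin N → Fin N → ℝ := fun i j l =>
    ∑ a, Λ x ![i, a] * pd (fun y => Λ y ![j, l]) a x with hX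
  have h₂ : ∑ i, ∑ j, ∑ l, pd h i x * pd k j x * pd g l x * X i j l =
      ∑ i, ∑ j, ∑ l, pd g i x * pd h j x * pd k l x * X j l i := by
    rw [sum_rotate fun i j l => pd g i x * pd h j x * pd k l x * X j l i]
    exact Finset.sum_congr rfl fun _ _ => Finset.sum_congr rfl fun _ _ =>
      Finset.sum_congr rfl fun _ _ => by ring
  have h₃ : ∑ i, ∑ j, ∑ l, pd k i x * pd g j x * pd h l x * X i j l =
      ∑ i, ∑ j, ∑ l, pd g i x * pd h j x * pd k l x * X l i j := by
    rw [sum_rotate fun i j l => pd k i x * pd g j x * pd h l x * X i j l]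
    exact Finset.sum_congr rfl fun _ _ => Finset.sum_congr rfl fun _ _ =>
      Finset.sum_congr rfl fun _ _ => by ring
  linarith

theorem jacobiOn_iff_schouten (hM : IsOpen M) (hΛ : IsFormOn Λ M) :
    JacobiOn Λ M ↔ ∀ x ∈ M, ∀ i j k, schouten Λ x i j k = 0 := by
  refine ⟨fun hJ x hx i j k => ?_, fun hS g h k hg hh hk x hx => ?_⟩
  · have hc (i : Fin N) : ContDiffOn ℝ (⊤ : ℕ∞) (fun y : Pt N => y i) M :=
      (contDiff_apply ℝ ℝ i).contDiffOn
    have hpd (i a : Fin N) : pd (fun y : Pt N => y i) a x = if a = i then 1 else 0 := by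
      have : fderiv ℝ (fun y : Pt N => y i) x = ContinuousLinearMap.proj i :=
        (ContinuousLinearMap.proj (R := ℝ) (φ := fun _ : Fin N => ℝ) i).fderiv
      simp [pd, this, Pi.single_apply, eq_comm]
    have := hJ _ _ _ (hc i) (hc j) (hc k) x hx
    rw [jacobiator_eq hM hΛ (hc i) (hc j) (hc k) hx] at this
    simpa [hpd] using this
  · rw [jacobiator_eq hM hΛ hg hh hk hx]
    simp [hS x hx]

end Jacobi

theorem fin_three_eta {X : Type*} (I : Fin 3 → X) : I = ![I 0, I 1, I 2] := by
  ext t; fin_cases t <;> rfl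

theorem snoc_three {X : Type*} (i j k a : X) :
    (Fin.snoc ![i, j, k] a : Fin 4 → X) = ![i, j, k, a] := by
  ext t; fin_cases t <;> rfl

theorem snoc_one {X : Type*} (i a : X) : (Fin.snoc ![i] a : Fin 2 → X) = ![i, a] := by
  ext t; fin_cases t <;> rfl

/-- The two sides of the compatibility condition differ, in multivector terms, by a nonzero
multiple of the Schouten bracket. -/
theorem sharpF_deltaCond {n : ℕ} {M : Set (Pt (2 * n))} (hM : IsOpen M)
    {ω₀ Λ₀ σ : Form (2 * n) 2} (hω : IsFormOn ω₀ M) (hΛ : IsFormOn Λ₀ M) (hσ : IsFormOn σ M)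
    {x : Pt (2 * n)} (hx : x ∈ M) (i j k : Fin (2 * n)) :
    sharpF Λ₀ 3 (codiffF ω₀ Λ₀ 4 (wedgeF 2 2 σ σ)) x ![i, j, k] -
      sharpF Λ₀ 3 (smulF 2 (wedgeF 2 1 σ (codiffF ω₀ Λ₀ 2 σ))) x ![i, j, k] =
      2 * volF n ω₀ x id ^ 2 * (mat2 Λ₀ x).det * schouten (sharpF Λ₀ 2 σ) x i j k := by
  set f : Pt (2 * n) → ℝ := fun y => volF n ω₀ y id with hf
  set A : Form (2 * n) 2 := sharpF Λ₀ 2 σ with hA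
  have hAf : IsFormOn A M := hΛ.sharpF hσ
  have df : DifferentiableAt ℝ f x := differentiableAt_of_contDiffOn hM
    (contDiffOn_const.mul (contDiffOn_wpow hω.2 n _)) hx
  have dA (i j) : DifferentiableAt ℝ (fun y => A y ![i, j]) x :=
    differentiableAt_of_contDiffOn hM (hAf.2 _) hx
  have h₂ (i : Fin (2 * n)) : sharpF Λ₀ 1 (codiffF ω₀ Λ₀ 2 σ) x ![i] =
      f x * (mat2 Λ₀ x).det * ∑ a, (pd f a x * A x ![i, a] + f x * pd (fun y => A y ![i, a]) a x) := by
    rw [sharpF_codiffF hM hω hΛ odd_one hσ hx]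
    congr 1
    refine Finset.sum_congr rfl fun a _ => ?_
    rw [snoc_one, pd, fderiv_fun_mul df (dA i a)]
    simp only [add_apply, smul_apply, smul_eq_mul, pd]
    ring
  have h₄ : sharpF Λ₀ 3 (codiffF ω₀ Λ₀ 4 (wedgeF 2 2 σ σ)) x ![i, j, k] =
      f x * (mat2 Λ₀ x).det * ∑ a, 2 * (pd f a x * (A x ![i, j] * A x ![k, a] -
          A x ![i, k] * A x ![j, a] + A x ![i, a] * A x ![j, k]) +
        f x * (A x ![i, j] * pd (fun y => A y ![k, a]) a x +
          A x ![k, a] * pd (fun y => A y ![i, j]) a x -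
          A x ![i, k] * pd (fun y => A y ![j, a]) a x -
          A x ![j, a] * pd (fun y => A y ![i, k]) a x +
          A x ![i, a] * pd (fun y => A y ![j, k]) a x +
          A x ![j, k] * pd (fun y => A y ![i, a]) a x)) := by
    rw [sharpF_codiffF hM hω hΛ (by decide : Odd 3) (hσ.wedgeF hσ) hx]
    congr 1
    refine Finset.sum_congr rfl fun a _ => ?_
    have he : (fun y => volF n ω₀ y id * sharpF Λ₀ (3 + 1) (wedgeF 2 2 σ σ) y
        (Fin.snoc ![i, j, k] a : Fin 4 → Fin (2 * n))) =ᶠ[nhds x]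
        fun y => f y * (2 * (A y ![i, j] * A y ![k, a] - A y ![i, k] * A y ![j, a] +
          A y ![i, a] * A y ![j, k])) := by
      filter_upwards [hM.mem_nhds hx] with y hy
      rw [snoc_three]
      exact congrArg (f y * ·) ((sharpF_wedgeF Λ₀ 2 2 σ σ y _).trans
        (wedgeF_two_two (hAf.1 y hy) i j k a))
    have hd := df.hasFDerivAt.mul ((((((dA i j).hasFDerivAt.mul (dA k a).hasFDerivAt).sub
      ((dA i k).hasFDerivAt.mul (dA j a).hasFDerivAt)).add
      ((dA i a).hasFDerivAt.mul (dA j k).hasFDerivAt))).const_mul 2)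
    rw [pd, he.fderiv_eq]
    erw [hd.fderiv]
    simp only [add_apply, sub_apply, smul_apply, smul_eq_mul, pd, Pi.mul_apply, Pi.add_apply, Pi.sub_apply]
    ring
  have h₃ : sharpF Λ₀ 3 (smulF 2 (wedgeF 2 1 σ (codiffF ω₀ Λ₀ 2 σ))) x ![i, j, k] =
      2 * (A x ![i, j] * sharpF Λ₀ 1 (codiffF ω₀ Λ₀ 2 σ) x ![k] -
        A x ![i, k] * sharpF Λ₀ 1 (codiffF ω₀ Λ₀ 2 σ) x ![j] +
        A x ![j, k] * sharpF Λ₀ 1 (codiffF ω₀ Λ₀ 2 σ) x ![i]) := by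
    rw [← wedgeF_two_one (hAf.1 x hx), hA, ← sharpF_wedgeF]
    simp only [sharpF, smulF, Finset.mul_sum]
    exact Finset.sum_congr rfl fun _ _ => by ring
  have hsw (a) : pd (fun y => A y ![i, k]) a x = -pd (fun y => A y ![k, i]) a x := by
    have he : (fun y => A y ![i, k]) =ᶠ[nhds x] fun y => -A y ![k, i] := by
      filter_upwards [hM.mem_nhds hx] with y hy
      exact (hAf.1 y hy).swap_two k i
    rw [pd, he.fderiv_eq, fderiv_fun_neg]
    rfl
  rw [h₃, h₄, h₂, h₂, h₂, schouten]
  simp only [Finset.mul_sum, ← Finset.sum_sub_distrib, ← Finset.sum_add_distrib]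
  refine Finset.sum_congr rfl fun a _ => ?_
  rw [hsw]
  ring

theorem deltaCond_iff_schouten {n : ℕ} {M : Set (Pt (2 * n))} (hM : IsOpen M)
    {ω₀ Λ₀ σ : Form (2 * n) 2} (hsymp : AlmostSymp ω₀ Λ₀ M) (hσ : IsFormOn σ M) :
    DeltaCond ω₀ Λ₀ σ M ↔ ∀ x ∈ M, ∀ i j k, schouten (sharpF Λ₀ 2 σ) x i j k = 0 := by
  obtain ⟨hω, hΛ, hinv⟩ := hsymp
  refine forall₂_congr fun x hx => ?_
  have hC : 2 * volF n ω₀ x id ^ 2 * (mat2 Λ₀ x).det ≠ 0 := by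
    have hdet : (mat2 Λ₀ x).det ≠ 0 := by
      refine (Matrix.isUnit_det_of_left_inverse (B := -mat2 ω₀ x) ?_).ne_zero
      rw [neg_mul, hinv x hx, neg_neg]
    have := volF_ne_zero (n := n) (hω.1 x hx) (hinv x hx)
    positivity
  refine ⟨fun h i j k => ?_, fun h => congrFun (f := smulF 2 (wedgeF 2 1 σ (codiffF ω₀ Λ₀ 2 σ)) x)
    (pullArr_injective (hinv x hx) (funext fun I => ?_))⟩
  · refine (mul_eq_zero.mp (Eq.trans (sharpF_deltaCond hM hω hΛ hσ hx i j k).symm ?_)).resolve_left hC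
    rw [sub_eq_zero, sharpF_eq_pullArr, sharpF_eq_pullArr, funext h]
  · have := sharpF_deltaCond hM hω hΛ hσ hx (I 0) (I 1) (I 2)
    rw [h, mul_zero, ← fin_three_eta, sharpF_eq_pullArr, sharpF_eq_pullArr] at this
    linarith

/-!
STATEMENT 3.  For an almost symplectic structure `ω₀` (with associated bivector
field `Λ₀`) on `M ⊆ ℝ^{2n}` and a `2`-form `σ`, the bivector field
`Λ = Λ₀^#(σ)` is a Poisson tensor on `M` if and only if `2σ∧δ(σ) = δ(σ∧σ)`,
where `δ = *∘d∘*` is the codifferential associated with `ω₀`.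
-/
theorem poisson_iff_delta_condition
    (n : ℕ) (hn : 1 ≤ n)
    (M : Set (Pt (2 * n))) (hMo : IsOpen M) (hMne : M.Nonempty)
    (ω₀ Λ₀ : Form (2 * n) 2) (hsymp : AlmostSymp ω₀ Λ₀ M)
    (σ : Form (2 * n) 2) (hσ : IsFormOn σ M) :
    JacobiOn (sharpF Λ₀ 2 σ) M ↔ DeltaCond ω₀ Λ₀ σ M :=
  (jacobiOn_iff_schouten hMo (hsymp.2.1.sharpF hσ)).trans
    (deltaCond_iff_schouten hMo hsymp hσ).symm

end
end Damianou
end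

section
/- Let 2 ≤ k ≤ n, let f₁, …, f_{2n−2k} be smooth functions on M functionally independent at every point of an open dense subset of M, and let ω₀ be an almost symplectic structure on M such that f = ⟨df₁∧⋯∧df_{2n−2k}, Λ₀^{n−k}/(n−k)!⟩ is nonvanishing on an open dense subset U of M. Let σ be a differential 2-form on M and Λ = Λ₀^#(σ) the bivector field defined by Λ(α,β) = σ(Λ₀^#(α), Λ₀^#(β)), and assume Λ has rank at most 2k at every point of M. Then the following are equivalent: (1) Λ(df_i,·) = 0 for every i = 1,…,2n−2k and, at every point x ∈ U, the kernel of the linear map α ↦ Λ_x(α,·) is exactly the span of df₁(x),…,df_{2n−2k}(x); (2) σ(X_{f_i}, ·) = 0 for every i = 1,…,2n−2k and σ has rank 2k at every point of U. -/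
namespace Damianou

noncomputable section

/-- A wedge of `1`-forms has the determinants of their values as components. -/
theorem wedgeList_eq_det {N : ℕ} (x : Pt N) :
    ∀ (m : ℕ) (α : Fin m → Form N 1) (I : Fin m → Fin N),
    wedgeList m α x I = (Matrix.of fun i j => α i x fun _ => I j).det
  | 0, α, I => by simp [wedgeList]
  | m + 1, α, I => by
    have ih := wedgeList_eq_det x m fun i => α i.castSucc
    have key : ∀ τ : Equiv.Perm (Fin m),
        ∑ σ : Equiv.Perm (Fin (m + 1)), ((Equiv.Perm.sign σ : ℤ) : ℝ) *
          (((Equiv.Perm.sign τ : ℤ) : ℝ) *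
            ∏ i : Fin m, α i.castSucc x fun _ => I (σ (Fin.castAdd 1 (τ i)))) *
          (α (Fin.last m) x fun _ => I (σ (Fin.natAdd m 0))) =
        ∑ σ : Equiv.Perm (Fin (m + 1)), ((Equiv.Perm.sign σ : ℤ) : ℝ) *
          ∏ i : Fin (m + 1), α i x fun _ => I (σ i) := by
      intro τ
      let τ' : Equiv.Perm (Fin (m + 1)) :=
        finSumFinEquiv.permCongr (Equiv.Perm.sumCongr τ (1 : Equiv.Perm (Fin 1)))
      have h1 : ∀ i, τ' (Fin.castSucc i) = Fin.castAdd 1 (τ i) := by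
        intro i
        have : Fin.castSucc i = finSumFinEquiv (Sum.inl i : Fin m ⊕ Fin 1) := rfl
        rw [this]
        simp [τ', Equiv.permCongr_apply]
      have h2 : τ' (Fin.last m) = Fin.natAdd m 0 := by
        have : Fin.last m = finSumFinEquiv (Sum.inr 0 : Fin m ⊕ Fin 1) := rfl
        rw [this]
        simp [τ', Equiv.permCongr_apply]
      have hs : Equiv.Perm.sign τ' = Equiv.Perm.sign τ := by
        simp [τ']
      rw [← Equiv.sum_comp (Equiv.mulRight τ') (fun σ : Equiv.Perm (Fin (m + 1)) =>
        ((Equiv.Perm.sign σ : ℤ) : ℝ) * ∏ i : Fin (m + 1), α i x fun _ => I (σ i))]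
      refine Finset.sum_congr rfl fun σ _ => ?_
      rw [Equiv.coe_mulRight, Fin.prod_univ_castSucc]
      simp only [Equiv.Perm.mul_apply, h1, h2, Equiv.Perm.sign_mul, hs, Units.val_mul, Int.cast_mul]
      ring
    have hm : (m.factorial : ℝ) ≠ 0 := by exact_mod_cast m.factorial_ne_zero
    rw [← Matrix.det_transpose, Matrix.det_apply']
    simp only [wedgeList, wedgeF, ih, Matrix.transpose_apply, Matrix.of_apply]
    simp only [← Matrix.det_transpose (Matrix.of _), Matrix.det_apply', Matrix.transpose_apply,
      Matrix.of_apply, Finset.mul_sum, Finset.sum_mul]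
    rw [Finset.sum_comm]
    simp only [← Finset.mul_sum, Nat.factorial_one, Nat.cast_one, mul_one]
    have hc : ∀ (σ : Equiv.Perm (Fin (m + 1))),
        (fun j : Fin 1 => I (σ (Fin.natAdd m j))) = fun _ => I (σ (Fin.natAdd m 0)) := by
      intro σ; funext j; rw [Subsingleton.elim j 0]
    simp only [hc]
    rw [Finset.sum_congr rfl fun τ _ => key τ]
    simp [Fintype.card_perm, hm]

/-- Functions whose differentials have a nonzero wedge component are independent. -/
theorem linearIndependent_grad_of_wedgeList_ne_zero {N m : ℕ} {f : Fin m → Pt N → ℝ} {x : Pt N}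
    {I : Fin m → Fin N} (h : wedgeList m (fun i => dF (f i)) x I ≠ 0) :
    LinearIndependent ℝ fun i => grad (f i) x := by
  rw [wedgeList_eq_det] at h
  exact LinearIndependent.of_comp (LinearMap.funLeft ℝ ℝ I)
    (Matrix.linearIndependent_rows_of_det_ne_zero h)

theorem exists_ne_zero_of_pairF_ne_zero {N p : ℕ} {η P : Form N p} {x : Pt N}
    (h : pairF η P x ≠ 0) : ∃ I, η x I ≠ 0 := by
  contrapose! h
  simp [pairF, h]

theorem mat2_transpose {N : ℕ} {ω : Form N 2} {x : Pt N} (h : AltArr (ω x)) :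
    (mat2 ω x).transpose = -mat2 ω x := by
  ext i j
  have := h.1 ![i, j] (Equiv.swap 0 1)
  have e : ![i, j] ∘ Equiv.swap (0 : Fin 2) 1 = ![j, i] := by
    funext t; fin_cases t <;> simp
  rw [e] at this
  simpa [mat2] using this

theorem mat2_sharpF {N : ℕ} (Λ σ : Form N 2) (x : Pt N) :
    mat2 (sharpF Λ 2 σ) x = (mat2 Λ x).transpose * mat2 σ x * mat2 Λ x := by
  ext a b
  simp only [mat2, sharpF, Matrix.mul_apply, Matrix.of_apply, Matrix.transpose_apply,
    Fin.prod_univ_two]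
  rw [← (finTwoArrowEquiv (Fin N)).symm.sum_comp, Fintype.sum_prod_type, Finset.sum_comm]
  simp only [finTwoArrowEquiv, Finset.sum_mul]
  norm_num
  refine Finset.sum_congr rfl fun j _ => Finset.sum_congr rfl fun i _ => ?_
  ring

theorem forall_sum_mul_eq_zero_iff {N : ℕ} (ω : Form N 2) (x : Pt N) (v : Fin N → ℝ) :
    (∀ b, ∑ a, ω x ![a, b] * v a = 0) ↔ (mat2 ω x).transpose.mulVec v = 0 := by
  rw [funext_iff]
  rfl

theorem hamV_eq_mulVec {N : ℕ} (Λ : Form N 2) (f : Pt N → ℝ) (x : Pt N) :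
    hamV Λ f x = (mat2 Λ x).transpose.mulVec (grad f x) := rfl

/-- `Λ₀^#(σ)` annihilates `df` exactly when `σ` annihilates the hamiltonian vector field of `f`. -/
theorem sharpF_grad_eq_zero_iff {N : ℕ} {Λ σ : Form N 2} {x : Pt N} (h : AltArr (Λ x))
    (hu : IsUnit (mat2 Λ x)) (f : Pt N → ℝ) :
    (∀ b, ∑ a, sharpF Λ 2 σ x ![a, b] * grad f x a = 0) ↔
      ∀ b, ∑ a, σ x ![a, b] * hamV Λ f x a = 0 := by
  have hinj := Matrix.mulVec_injective_of_isUnit hu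
  rw [forall_sum_mul_eq_zero_iff, forall_sum_mul_eq_zero_iff, mat2_sharpF, hamV_eq_mulVec,
    Matrix.transpose_mul, Matrix.transpose_mul, Matrix.transpose_transpose, mat2_transpose h]
  simp only [Matrix.neg_mul, Matrix.neg_mulVec, Matrix.mulVec_neg, neg_eq_zero,
    ← Matrix.mulVec_mulVec]
  rw [← Matrix.mulVec_zero (mat2 Λ x), hinj.eq_iff, Matrix.mulVec_zero]

theorem rank_mat2_sharpF {N : ℕ} {Λ : Form N 2} (σ : Form N 2) {x : Pt N}
    (hu : IsUnit (mat2 Λ x)) : (mat2 (sharpF Λ 2 σ) x).rank = (mat2 σ x).rank := by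
  have hd := (Matrix.isUnit_iff_isUnit_det _).1 hu
  rw [mat2_sharpF, Matrix.rank_mul_eq_left_of_isUnit_det _ _ hd,
    Matrix.rank_mul_eq_right_of_isUnit_det _ _ (by rwa [Matrix.det_transpose])]

/-- An independent family in the kernel of `Aᵀ` spans it exactly when it has the right size. -/
theorem ker_eq_span_iff_rank {N m : ℕ} (A : Matrix (Fin N) (Fin N) ℝ) (v : Fin m → Fin N → ℝ)
    (hv : LinearIndependent ℝ v) (h0 : ∀ i, A.transpose.mulVec (v i) = 0) :
    (∀ α, A.transpose.mulVec α = 0 ↔ α ∈ Submodule.span ℝ (Set.range v)) ↔ A.rank + m = N := by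
  have hs : Module.finrank ℝ (Submodule.span ℝ (Set.range v)) = m := by
    simpa using finrank_span_eq_card hv
  have hr : A.rank + Module.finrank ℝ (LinearMap.ker A.transpose.mulVecLin) = N := by
    have := LinearMap.finrank_range_add_finrank_ker A.transpose.mulVecLin
    rwa [← Matrix.rank, Matrix.rank_transpose, Module.finrank_fin_fun] at this
  have hle : Submodule.span ℝ (Set.range v) ≤ LinearMap.ker A.transpose.mulVecLin := by
    rw [Submodule.span_le]
    rintro _ ⟨i, rfl⟩
    exact h0 i
  constructor
  · intro h
    have : LinearMap.ker A.transpose.mulVecLin = Submodule.span ℝ (Set.range v) := by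
      ext α; exact h α
    rwa [this, hs] at hr
  · intro h α
    have := Submodule.eq_of_le_of_finrank_eq hle (by omega)
    rw [this]
    rfl

/-!
STATEMENT 4.  Characterization of bivector fields `Λ = Λ₀^#(σ)` of rank at most
`2k` which admit `f₁,…,f_{2(n-k)}` as their only Casimirs:  `Λ(df_i,·) = 0` for
all `i` together with `ker(α ↦ Λ_x(α,·)) = span(df₁(x),…,df_{2(n-k)}(x))` at
every `x ∈ U`, if and only if `σ(X_{f_i},·) = 0` for all `i` and `σ` has rank
`2k` at every point of `U`.
-/
theorem casimir_characterization_via_sigma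
    (n k : ℕ) (hk : 2 ≤ k) (hkn : k ≤ n)
    (M : Set (Pt (2 * n))) (hMo : IsOpen M) (hMne : M.Nonempty)
    (f : Fin (2 * (n - k)) → Pt (2 * n) → ℝ)
    (hf : ∀ i, ContDiffOn ℝ (⊤ : ℕ∞) (f i) M)
    -- functional independence on an open dense subset U₁ of M
    (U₁ : Set (Pt (2 * n))) (hU₁o : IsOpen U₁) (hU₁M : U₁ ⊆ M) (hU₁d : M ⊆ closure U₁)
    (hind : ∀ x ∈ U₁, LinearIndependent ℝ fun i => grad (f i) x)
    -- almost symplectic structure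
    (ω₀ Λ₀ : Form (2 * n) 2) (hsymp : AlmostSymp ω₀ Λ₀ M)
    -- f = ⟨df₁∧⋯∧df_{2(n-k)}, Λ₀^{n-k}/(n-k)!⟩ nonvanishing on an open dense U ⊆ M
    (U : Set (Pt (2 * n))) (hUo : IsOpen U) (hUM : U ⊆ M) (hUd : M ⊆ closure U)
    (hfne : ∀ x ∈ U,
      pairF (wedgeList (2 * (n - k)) fun i => dF (f i))
        (smulF (((n - k).factorial : ℝ)⁻¹) (wpow Λ₀ (n - k))) x ≠ 0)
    -- the 2-form σ corresponding to Λ, of rank at most 2k everywhere on M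
    (σ : Form (2 * n) 2) (hσ : IsFormOn σ M)
    (hrank : ∀ x ∈ M, Matrix.rank (mat2 (sharpF Λ₀ 2 σ) x) ≤ 2 * k) :
    ((∀ i, ∀ x ∈ M, ∀ b, ∑ a, sharpF Λ₀ 2 σ x ![a, b] * grad (f i) x a = 0) ∧
      (∀ x ∈ U, ∀ α : Fin (2 * n) → ℝ,
        (∀ b, ∑ a, sharpF Λ₀ 2 σ x ![a, b] * α a = 0) ↔
          α ∈ Submodule.span ℝ (Set.range fun i => grad (f i) x)))
    ↔
    ((∀ i, ∀ x ∈ M, ∀ b, ∑ a, σ x ![a, b] * hamV Λ₀ (f i) x a = 0) ∧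
      ∀ x ∈ U, Matrix.rank (mat2 σ x) = 2 * k) := by
  have hu : ∀ x ∈ M, IsUnit (mat2 Λ₀ x) := fun x hx =>
    IsUnit.of_mul_eq_one_right (-mat2 ω₀ x) (by rw [Matrix.neg_mul, hsymp.2.2 x hx, neg_neg])
  have hfirst : (∀ i, ∀ x ∈ M, ∀ b, ∑ a, sharpF Λ₀ 2 σ x ![a, b] * grad (f i) x a = 0) ↔
      ∀ i, ∀ x ∈ M, ∀ b, ∑ a, σ x ![a, b] * hamV Λ₀ (f i) x a = 0 :=
    forall_congr' fun i => forall₂_congr fun x hx =>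
      sharpF_grad_eq_zero_iff (hsymp.2.1.1 x hx) (hu x hx) (f i)
  rw [← hfirst]
  refine and_congr_right fun h0 => forall₂_congr fun x hx => ?_
  obtain ⟨I, hI⟩ := exists_ne_zero_of_pairF_ne_zero (hfne x hx)
  have hlin := linearIndependent_grad_of_wedgeList_ne_zero hI
  simp only [forall_sum_mul_eq_zero_iff]
  rw [ker_eq_span_iff_rank _ _ hlin fun i =>
    (forall_sum_mul_eq_zero_iff _ _ _).1 (h0 i x (hUM hx)), rank_mat2_sharpF σ (hu x (hUM hx))]
  omega

end
end Damianou
end
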